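/- arXiv:1212.4187 — 2 statements merged into one kernel-verified Lean document; each statement's English description precedes it below -/
import Mathlib

section
/- (Furstenberg–Katznelson IP multiple recurrence) Let (X, ℬ, μ) be a measure space with μ(X) = 1, let k ∈ ℕ, and for each 1 ≤ j ≤ k let (T_n^{(j)})_{n∈ℕ} be measure-preserving transformations of X such that the whole family {T_n^{(j)} : n ∈ ℕ, 1 ≤ j ≤ k} is commuting (T_n^{(i)}T_m^{(j)} = T_m^{(j)}T_n^{(i)} for all n, m, i, j). For a nonempty finite set α = {t_1 < … < t_l} ⊆ ℕ, let 𝒯_α^{(j)} = T_{t_1}^{(j)}∘…∘T_{t_l}^{(j)}. Then for every A ∈ ℬ with μ(A) > 0 there exists a nonempty finite set α ⊆ ℕ such that μ(A ∩ (𝒯_α^{(1)})^{-1}(A) ∩ … ∩ (𝒯_α^{(k)})^{-1}(A)) > 0. -/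
open MeasureTheory

/-- The IP-system transformation `𝒯_α = T_{t_1} ∘ … ∘ T_{t_l}` attached to a finite set
`α = {t_1 < … < t_l}` of indices. -/
def ipTrans {X : Type*} (T : ℕ → X → X) (α : Finset ℕ) : X → X :=
  (α.sort (· ≤ ·)).foldr (fun t f => T t ∘ f) id

noncomputable section
namespace DHJ
open Combinatorics

/-! ### Subspaces -/

/-- A subspace inside a subspace. -/
def comp {ζ η α ι : Type} (V : Subspace η α ι) (U : Subspace ζ α η) : Subspace ζ α ι where
  idxFun i := (V.idxFun i).elim Sum.inl U.idxFun
  proper e := by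
    obtain ⟨j, hj⟩ := U.proper e
    obtain ⟨i, hi⟩ := V.proper j
    exact ⟨i, by simp [hi, hj]⟩

theorem comp_apply {ζ η α ι : Type} (V : Subspace η α ι) (U : Subspace ζ α η) (x : ζ → α) :
    comp V U x = V (U x) := by
  funext i
  cases h : V.idxFun i <;> simp [Subspace.coe_apply, comp, h]

/-- A line inside a subspace. -/
def mapLine {η α ι : Type} (V : Subspace η α ι) (l : Line α η) : Line α ι where
  idxFun i := (V.idxFun i).elim some l.idxFun
  proper := by
    obtain ⟨j, hj⟩ := l.proper
    obtain ⟨i, hi⟩ := V.proper j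
    exact ⟨i, by simp [hi, hj]⟩

theorem mapLine_apply {η α ι : Type} (V : Subspace η α ι) (l : Line α η) (a : α) :
    mapLine V l a = V (l a) := by
  funext i
  cases h : V.idxFun i <;> simp [Subspace.coe_apply, mapLine, h]

/-- A subspace times a point. -/
def prodPt {η α ι ι' : Type} (V : Subspace η α ι) (y : ι' → α) : Subspace η α (ι ⊕ ι') where
  idxFun := Sum.elim V.idxFun (fun i => Sum.inl (y i))
  proper e := by
    obtain ⟨i, hi⟩ := V.proper e
    exact ⟨Sum.inl i, by simp [hi]⟩

theorem prodPt_apply {η α ι ι' : Type} (V : Subspace η α ι) (y : ι' → α) (x : η → α) :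
    prodPt V y x = Sum.elim (V x) y := by
  funext i
  cases i <;> simp [Subspace.coe_apply, prodPt]

/-- A point times a subspace. -/
def ptProd {η α ι ι' : Type} (y : ι' → α) (V : Subspace η α ι) : Subspace η α (ι' ⊕ ι) where
  idxFun := Sum.elim (fun i => Sum.inl (y i)) V.idxFun
  proper e := by
    obtain ⟨i, hi⟩ := V.proper e
    exact ⟨Sum.inr i, by simp [hi]⟩

theorem ptProd_apply {η α ι ι' : Type} (V : Subspace η α ι) (y : ι' → α) (x : η → α) :
    ptProd y V x = Sum.elim y (V x) := by
  funext i
  cases i <;> simp [Subspace.coe_apply, ptProd]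

/-- A line times a subspace. -/
def lineProd {α ι ι' : Type} {d : ℕ} (l : Line α ι) (V : Subspace (Fin d) α ι') :
    Subspace (Fin (d + 1)) α (ι ⊕ ι') where
  idxFun := Sum.elim (fun i => (l.idxFun i).elim (Sum.inr 0) Sum.inl)
    (fun i => (V.idxFun i).map id Fin.succ)
  proper e := by
    refine Fin.cases ?_ (fun e => ?_) e
    · obtain ⟨i, hi⟩ := l.proper
      exact ⟨Sum.inl i, by simp [hi]⟩
    · obtain ⟨i, hi⟩ := V.proper e
      exact ⟨Sum.inr i, by simp [hi]⟩

theorem lineProd_apply {α ι ι' : Type} {d : ℕ} (l : Line α ι) (V : Subspace (Fin d) α ι')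
    (x : Fin (d + 1) → α) :
    lineProd l V x = Sum.elim (l (x 0)) (V (Fin.tail x)) := by
  funext i
  cases i with
  | inl i => cases h : l.idxFun i <;> simp [Subspace.coe_apply, lineProd, h]
  | inr i => cases h : V.idxFun i <;> simp [Subspace.coe_apply, lineProd, h, Fin.tail]

/-- Extend the alphabet by a letter. -/
def ext {η κ ι : Type} (V : Subspace η κ ι) : Subspace η (Option κ) ι where
  idxFun i := (V.idxFun i).map some id
  proper e := by
    obtain ⟨i, hi⟩ := V.proper e
    exact ⟨i, by simp [hi]⟩

theorem ext_some {η κ ι : Type} (V : Subspace η κ ι) (x : η → κ) :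
    ext V (some ∘ x) = some ∘ V x := by
  funext i
  cases h : V.idxFun i <;> simp [Subspace.coe_apply, ext, h]

theorem ext_comp {ζ η κ ι : Type} (V : Subspace η κ ι) (U : Subspace ζ κ η) (x : ζ → Option κ) :
    ext (comp V U) x = ext V (ext U x) := by
  funext i
  cases h : V.idxFun i <;> simp [Subspace.coe_apply, ext, h, comp]

theorem ext_lineProd {κ ι ι' : Type} {d : ℕ} (l : Line κ ι) (V : Subspace (Fin d) κ ι')
    (x : Fin (d + 1) → Option κ) :
    ext (lineProd l V) x = Sum.elim ((l.map some) (x 0)) (ext V (Fin.tail x)) := by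
  funext i
  cases i with
  | inl i => cases h : l.idxFun i <;> simp [Subspace.coe_apply, lineProd, h, ext, Line.map]
  | inr i => cases h : V.idxFun i <;> simp [Subspace.coe_apply, lineProd, h, Fin.tail, ext]

theorem sub_injective {η α ι : Type} (V : Subspace η α ι) :
    Function.Injective (fun x : η → α => V x) := by
  intro x y h
  funext e
  obtain ⟨i, hi⟩ := V.proper e
  have := congrFun h i
  simpa [Subspace.coe_apply, hi] using this

/-- Reindexing coordinates. -/
def reidx {η α ι ι' : Type} (V : Subspace η α ι') (e : ι ≃ ι') : Subspace η α ι where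
  idxFun i := V.idxFun (e i)
  proper a := by
    obtain ⟨i, hi⟩ := V.proper a
    exact ⟨e.symm i, by simp [hi]⟩

theorem reidx_apply {η α ι ι' : Type} (V : Subspace η α ι') (e : ι ≃ ι') (x : η → α) :
    reidx V e x = (V x) ∘ e := by
  funext i
  simp [Subspace.coe_apply, reidx]

/-- Reindexing coordinates of a line. -/
def reLine {α ι ι' : Type} (l : Line α ι') (e : ι ≃ ι') : Line α ι where
  idxFun i := l.idxFun (e i)
  proper := by
    obtain ⟨i, hi⟩ := l.proper
    exact ⟨e.symm i, by simp [hi]⟩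

theorem reLine_apply {α ι ι' : Type} (l : Line α ι') (e : ι ≃ ι') (a : α) :
    reLine l e a = (l a) ∘ e := by
  funext i
  simp [reLine]

/-! ### A Graham-Rothschild type theorem -/

theorem step1 (κ : Type) [Finite κ] (R : ℕ) : ∀ (C : Type) [Finite C],
    ∃ (ι : Type) (_ : Fintype ι), ∀ χ : (ι → Option κ) → C, ∃ W : Subspace (Fin R) κ ι,
      ∀ y y' : Fin R → Option κ, (∀ e, y e = none ↔ y' e = none) →
        χ (ext W y) = χ (ext W y') := by
  induction R with
  | zero =>
    intro C _
    refine ⟨Empty, inferInstance, fun χ => ⟨⟨fun e => e.elim, fun e => e.elim0⟩, ?_⟩⟩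
    intro y y' _
    rw [Subsingleton.elim y y']
  | succ R ih =>
    intro C _
    obtain ⟨ι', hf', h'⟩ := ih (Option κ → C)
    obtain ⟨ι, hf, h⟩ := Line.exists_mono_in_high_dimension κ ((ι' → Option κ) → C)
    refine ⟨ι ⊕ ι', inferInstance, fun χ => ?_⟩
    obtain ⟨l, c, hl⟩ := h (fun x v => χ (Sum.elim (some ∘ x) v))
    obtain ⟨W, hW⟩ := h' (fun v o => χ (Sum.elim ((l.map some) o) v))
    refine ⟨lineProd l W, fun y y' hy => ?_⟩
    rw [ext_lineProd, ext_lineProd]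
    have h1 := congrFun (hW (Fin.tail y) (Fin.tail y') (fun e => hy _)) (y 0)
    rw [h1]
    have h0 := hy 0
    rcases hy0 : y 0 with _ | a <;> rcases hy0' : y' 0 with _ | b
    · rfl
    · simp [hy0, hy0'] at h0
    · simp [hy0, hy0'] at h0
    · rw [Line.map_apply, Line.map_apply]
      have := congrFun ((hl a).trans (hl b).symm) (ext W (Fin.tail y'))
      simpa using this

theorem folkman (R : ℕ) (C : Type) [Finite C] :
    ∃ (ι : Type) (_ : Fintype ι), ∀ χ : Set ι → C, ∃ (f : ι → Option (Fin R)) (c : Fin R → C),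
      (∀ j, ∃ t, f t = some j) ∧
      ∀ (i : Fin R) (J : Set (Fin R)), i ∈ J → (∀ j ∈ J, j ≤ i) →
        χ {t | ∃ j ∈ J, f t = some j} = c i := by
  classical
  induction R with
  | zero =>
    exact ⟨Empty, inferInstance, fun χ => ⟨fun e => e.elim, fun e => e.elim0,
      fun e => e.elim0, fun e => e.elim0⟩⟩
  | succ R ih =>
    obtain ⟨ι0, hf0, h0⟩ := ih
    obtain ⟨ι1, hf1, h1⟩ := Subspace.exists_mono_in_high_dimension Prop C ι0
    refine ⟨Option ι1, inferInstance, fun χ => ?_⟩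
    obtain ⟨V, c, hV⟩ := h1 (fun x => χ {t | ∀ s, t = some s → x s})
    obtain ⟨f0, c0, hs0, hc0⟩ := h0 (fun B => χ {t | ∃ s', t = some s' ∧
      ∃ s ∈ B, V.idxFun s' = Sum.inr s})
    refine ⟨fun t => t.elim (some (Fin.last R)) (fun s => (V.idxFun s).elim
      (fun p => if p then some (Fin.last R) else none) (fun s => (f0 s).map Fin.castSucc)),
      Fin.lastCases c c0, ?_, ?_⟩
    · intro j
      refine Fin.lastCases ⟨none, rfl⟩ (fun j => ?_) j
      obtain ⟨s, hs⟩ := hs0 j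
      obtain ⟨t, ht⟩ := V.proper s
      exact ⟨some t, by simp [ht, hs]⟩
    · intro i
      refine Fin.lastCases ?_ (fun i => ?_) i
      · intro J hJ _
        beta_reduce
        rw [Fin.lastCases_last, ← hV (fun s => ∃ j, Fin.castSucc j ∈ J ∧ f0 s = some j)]
        congr 1
        ext t
        rcases t with _ | t
        · simpa using hJ
        · rcases hh : V.idxFun t with p | s
          · by_cases hp : p <;> simp [Subspace.coe_apply, hh, hp, hJ]
          · simp only [Option.elim_some, hh, Sum.elim_inr, Option.map_eq_some_iff,
              Set.mem_setOf_eq, Option.some.injEq, Subspace.coe_apply, forall_eq']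
            constructor
            · rintro ⟨j, hj, a, ha, rfl⟩
              exact ⟨a, hj, ha⟩
            · rintro ⟨a, hj, ha⟩
              exact ⟨_, hj, a, ha, rfl⟩
      · intro J hJ hmax
        have hlast : Fin.last R ∉ J := fun h => absurd (hmax _ h) (by
          simp [Fin.lt_def, Fin.le_def])
        beta_reduce
        rw [Fin.lastCases_castSucc, ← hc0 i (Fin.castSucc ⁻¹' J) hJ
          (fun j hj => by simpa using hmax _ hj)]
        congr 1
        ext t
        rcases t with _ | t
        · simpa using hlast
        · rcases hh : V.idxFun t with p | s
          · by_cases hp : p <;> simp [hh, hp, hlast]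
          · simp only [Option.elim_some, hh, Sum.elim_inr, Option.map_eq_some_iff,
              Set.mem_setOf_eq, Option.some.injEq, Set.mem_preimage, Sum.inr.injEq]
            constructor
            · rintro ⟨j, hj, a, ha, rfl⟩
              exact ⟨t, rfl, s, ⟨a, hj, ha⟩, hh⟩
            · rintro ⟨t', rfl, s', ⟨a, hj, ha⟩, h2⟩
              rw [hh] at h2
              cases h2
              exact ⟨_, hj, a, ha, rfl⟩

theorem graham_rothschild (κ : Type) [Finite κ] [Nonempty κ] (m0 m : ℕ) :
    ∃ (ι : Type) (_ : Fintype ι), ∀ good : (ι → Option κ) → Prop,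
      (∀ U : Subspace (Fin m0) κ ι, ∃ z, (∃ e, z e = none) ∧ good (ext U z)) →
      ∃ W : Subspace (Fin m) κ ι, ∀ z, (∃ e, z e = none) → good (ext W z) := by
  classical
  obtain ⟨ι0, hf0, h0⟩ := folkman (m0 + m) Prop
  obtain ⟨ι, hf, h⟩ := step1 κ (Fintype.card ι0) Prop
  refine ⟨ι, hf, fun good hgood => ?_⟩
  obtain ⟨a0⟩ := ‹Nonempty κ›
  obtain ⟨W1, hW1⟩ := h good
  let q := Fintype.equivFin ι0
  obtain ⟨f, c, hs, hc⟩ := h0 (fun B => good (ext W1 (fun e => if q.symm e ∈ B then none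
    else some a0)))
  have key : ∀ (p : ℕ) (j : Fin p → Fin (m0 + m)), Function.Injective j →
      ∃ U : Subspace (Fin p) κ ι, ∀ z, (∃ e, z e = none) → ∃ s, (good (ext U z) = c (j s)) := by
    intro p j hj
    let Us : Subspace (Fin p) κ (Fin (Fintype.card ι0)) :=
      { idxFun := fun e => if h : ∃ s, f (q.symm e) = some (j s) then Sum.inr h.choose
          else Sum.inl a0
        proper := by
          intro s
          obtain ⟨t, ht⟩ := hs (j s)
          have hex : ∃ s', f (q.symm (q t)) = some (j s') := ⟨s, by simpa using ht⟩
          refine ⟨q t, ?_⟩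
          rw [dif_pos hex]
          have := hex.choose_spec
          have h4 : f (q.symm (q t)) = some (j s) := by simpa using ht
          rw [← hj (Option.some.inj (h4.symm.trans this))] }
    refine ⟨comp W1 Us, fun z hz => ?_⟩
    obtain ⟨i, hi⟩ := (Set.toFinite (j '' {s | z s = none})).exists_maximal
      (by obtain ⟨e, he⟩ := hz; exact ⟨j e, e, he, rfl⟩)
    obtain ⟨s, hs', rfl⟩ := hi.1
    refine ⟨s, ?_⟩
    rw [← hc (j s) _ hi.1 (fun j' hj' => by
      rcases le_total j' (j s) with h | h
      · exact h
      · exact hi.2 hj' h), ext_comp]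
    apply hW1
    intro e
    by_cases hex : ∃ s, f (q.symm e) = some (j s)
    · have hsp := hex.choose_spec
      have h1 : Us.idxFun e = Sum.inr hex.choose := dif_pos hex
      simp only [Subspace.coe_apply, ext, h1, Sum.map_inr, Sum.elim_inr, id]
      have h2 : (q.symm e ∈ {t | ∃ j_1 ∈ j '' {s | z s = none}, f t = some j_1}) ↔
          z hex.choose = none := by
        constructor
        · rintro ⟨_, ⟨s', hs', rfl⟩, h3⟩
          rw [hsp] at h3
          rw [hj (Option.some.inj h3)]
          exact hs'
        · intro h3
          exact ⟨_, ⟨_, h3, rfl⟩, hsp⟩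
      simp only [h2]
      by_cases h3 : z hex.choose = none <;> simp [h3]
    · have h1 : Us.idxFun e = Sum.inl a0 := dif_neg hex
      have h2 : ¬ (q.symm e ∈ {t | ∃ j_1 ∈ j '' {s | z s = none}, f t = some j_1}) := by
        rintro ⟨_, ⟨s', hs', rfl⟩, h3⟩
        exact hex ⟨_, h3⟩
      rw [if_neg h2]
      simp [Subspace.coe_apply, ext, h1]
  have hcard : Fintype.card {i // c i} + Fintype.card {i // ¬ c i} = m0 + m := by
    rw [Fintype.card_subtype_compl, Fintype.card_fin]
    have := Fintype.card_subtype_le c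
    rw [Fintype.card_fin] at this
    omega
  by_cases hm : m ≤ Fintype.card {i // c i}
  · obtain ⟨emb⟩ : Nonempty (Fin m ↪ {i // c i}) :=
      Function.Embedding.nonempty_of_card_le (by simpa using hm)
    obtain ⟨W, hW⟩ := key m (fun s => (emb s).1) (Subtype.val_injective.comp emb.injective)
    refine ⟨W, fun z hz => ?_⟩
    obtain ⟨s, hs⟩ := hW z hz
    rw [hs]
    exact (emb s).2
  · obtain ⟨emb⟩ : Nonempty (Fin m0 ↪ {i // ¬ c i}) :=
      Function.Embedding.nonempty_of_card_le (by rw [Fintype.card_fin]; omega)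
    obtain ⟨U, hU⟩ := key m0 (fun s => (emb s).1) (Subtype.val_injective.comp emb.injective)
    obtain ⟨z, hz, hg⟩ := hgood U
    obtain ⟨s, hs⟩ := hU z hz
    rw [hs] at hg
    exact absurd hg (emb s).2

end DHJ
end

noncomputable section
namespace DHJ
open Combinatorics

/-! ### Counting -/

open Classical in
/-- Real-valued truth value. -/
def ind (p : Prop) : ℝ := if p then 1 else 0

theorem ind_pos {p : Prop} (h : p) : ind p = 1 := by simp [ind, h]
theorem ind_neg {p : Prop} (h : ¬ p) : ind p = 0 := by simp [ind, h]
theorem ind_nonneg (p : Prop) : 0 ≤ ind p := by unfold ind; split_ifs <;> norm_num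
theorem ind_le_one (p : Prop) : ind p ≤ 1 := by unfold ind; split_ifs <;> norm_num
theorem ind_mono {p q : Prop} (h : p → q) : ind p ≤ ind q := by
  by_cases hp : p
  · rw [ind_pos hp, ind_pos (h hp)]
  · rw [ind_neg hp]; exact ind_nonneg q

/-- The number of words. -/
def K (α ι : Type) [Fintype α] [Fintype ι] : ℝ := (Fintype.card α : ℝ) ^ (Fintype.card ι)

theorem K_nonneg (α ι : Type) [Fintype α] [Fintype ι] : 0 ≤ K α ι := by
  unfold K; positivity

theorem K_pos (α ι : Type) [Fintype α] [Fintype ι] [Nonempty α] : 0 < K α ι := by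
  unfold K
  have : 0 < Fintype.card α := Fintype.card_pos
  positivity

theorem one_le_K (α ι : Type) [Fintype α] [Fintype ι] [Nonempty α] : 1 ≤ K α ι := by
  unfold K
  have : 1 ≤ Fintype.card α := Fintype.card_pos
  exact one_le_pow₀ (by exact_mod_cast this)

theorem K_sum (α ι ι' : Type) [Fintype α] [Fintype ι] [Fintype ι'] :
    K α (ι ⊕ ι') = K α ι * K α ι' := by
  simp [K, pow_add]

theorem K_congr (α : Type) {ι ι' : Type} [Fintype α] [Fintype ι] [Fintype ι'] (e : ι ≃ ι') :
    K α ι = K α ι' := by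
  simp [K, Fintype.card_congr e]

theorem sum_words_const (α ι : Type) [Fintype α] [Fintype ι] [DecidableEq ι] (c : ℝ) :
    ∑ _x : ι → α, c = K α ι * c := by
  simp [K]

theorem sum_words_sum {α ι ι' : Type} [Fintype α] [Fintype ι] [Fintype ι'] [DecidableEq ι]
    [DecidableEq ι'] (f : (ι ⊕ ι' → α) → ℝ) :
    ∑ x, f x = ∑ x : ι → α, ∑ y : ι' → α, f (Sum.elim x y) := by
  rw [← Fintype.sum_prod_type' (fun x y => f (Sum.elim x y))]
  exact (Equiv.sum_comp (Equiv.sumArrowEquivProdArrow ι ι' α).symm f).symm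

theorem sum_words_reindex {α ι ι' : Type} [Fintype α] [Fintype ι] [Fintype ι'] [DecidableEq ι]
    [DecidableEq ι'] (e : ι ≃ ι') (f : (ι → α) → ℝ) :
    ∑ x : ι' → α, f (x ∘ e) = ∑ x, f x :=
  Equiv.sum_comp (Equiv.arrowCongr e.symm (Equiv.refl α)) f

theorem exists_split {ι : Type} [Fintype ι] {a b : ℕ} (h : a + b ≤ Fintype.card ι) :
    ∃ n, b ≤ n ∧ Nonempty (ι ≃ Fin a ⊕ Fin n) := by
  refine ⟨Fintype.card ι - a, by omega, ⟨Fintype.equivOfCardEq ?_⟩⟩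
  simp
  omega

/-- The density Hales-Jewett property for an alphabet. -/
def DHJ (α : Type) [Fintype α] : Prop :=
  ∀ δ : ℝ, 0 < δ → ∃ N : ℕ, ∀ (ι : Type) [Fintype ι] [DecidableEq ι], N ≤ Fintype.card ι →
    ∀ A : Set (ι → α), δ * K α ι ≤ ∑ x, ind (x ∈ A) → ∃ l : Line α ι, ∀ a, l a ∈ A

theorem avg_line {α ι Y : Type} [Fintype α] [Nonempty α] [Fintype ι] [DecidableEq ι]
    [Fintype Y] [Nonempty Y] (δ : ℝ)
    (hD : ∀ A : Set (ι → α), (δ / 2) * K α ι ≤ ∑ x, ind (x ∈ A) → ∃ l : Line α ι, ∀ a, l a ∈ A)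
    (hδ : 0 < δ) (B : (ι → α) → Y → Prop)
    (hB : δ * K α ι * Fintype.card Y ≤ ∑ y, ∑ x, ind (B x y)) :
    ∃ l : Line α ι, (δ / 2) / K (Option α) ι * Fintype.card Y ≤ ∑ y, ind (∀ a, B (l a) y) := by
  by_contra hcon
  push Not at hcon
  have hY : (0 : ℝ) < Fintype.card Y := by exact_mod_cast Fintype.card_pos
  have hK := K_pos α ι
  have hK' := K_pos (Option α) ι
  let G : (ι → Option α) → Y → Prop := fun w y => (∃ i, w i = none) ∧
    ∀ a, B (fun i => (w i).getD a) y
  have h1 : ∀ y, ∑ x, ind (B x y) ≤ (δ / 2) * K α ι + K α ι * ∑ w, ind (G w y) := by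
    intro y
    by_cases h : (δ / 2) * K α ι ≤ ∑ x, ind (B x y)
    · obtain ⟨l, hl⟩ := hD {x | B x y} h
      have h2 : 1 ≤ ∑ w, ind (G w y) := by
        have : ind (G l.idxFun y) = 1 := ind_pos ⟨l.proper, hl⟩
        rw [← this]
        exact Finset.single_le_sum (f := fun w => ind (G w y)) (fun w _ => ind_nonneg _)
          (Finset.mem_univ _)
      have h3 : ∑ x, ind (B x y) ≤ K α ι := by
        calc ∑ x, ind (B x y) ≤ ∑ _x : ι → α, (1 : ℝ) :=
              Finset.sum_le_sum (fun _ _ => ind_le_one _)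
          _ = K α ι := by rw [sum_words_const, mul_one]
      nlinarith
    · have h2 : 0 ≤ ∑ w, ind (G w y) := Finset.sum_nonneg (fun _ _ => ind_nonneg _)
      push Not at h
      nlinarith
  have h4 : ∀ w, ∑ y, ind (G w y) < (δ / 2) / K (Option α) ι * Fintype.card Y := by
    intro w
    by_cases hw : ∃ i, w i = none
    · refine lt_of_le_of_lt (Finset.sum_le_sum (fun y _ => ?_)) (hcon ⟨w, hw⟩)
      exact ind_mono (fun h => h.2)
    · have : ∑ y, ind (G w y) = 0 := Finset.sum_eq_zero (fun y _ => ind_neg (fun h => hw h.1))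
      rw [this]
      positivity
  have h5 : ∑ y, ∑ x, ind (B x y) ≤
      (δ / 2) * K α ι * Fintype.card Y + K α ι * ∑ w, ∑ y, ind (G w y) := by
    rw [Finset.sum_comm (f := fun w y => ind (G w y)), Finset.mul_sum]
    refine (Finset.sum_le_sum (fun y _ => h1 y)).trans ?_
    rw [Finset.sum_add_distrib]
    simp [mul_comm]
  have h6 : ∑ w, ∑ y, ind (G w y) < ∑ _w : ι → Option α, (δ / 2) / K (Option α) ι *
      Fintype.card Y := by
    refine Finset.sum_lt_sum_of_nonempty ⟨fun _ => none, Finset.mem_univ _⟩ (fun w _ => h4 w)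
  rw [sum_words_const] at h6
  have h7 : K (Option α) ι * ((δ / 2) / K (Option α) ι * Fintype.card Y) =
    (δ / 2) * Fintype.card Y := by field_simp
  rw [h7] at h6
  nlinarith

theorem mdhj {α : Type} [Fintype α] [Nonempty α] (h : DHJ α) (d : ℕ) :
    ∀ δ : ℝ, 0 < δ → ∃ N : ℕ, ∀ (ι : Type) [Fintype ι] [DecidableEq ι], N ≤ Fintype.card ι →
    ∀ A : Set (ι → α), δ * K α ι ≤ ∑ x, ind (x ∈ A) →
      ∃ V : Subspace (Fin d) α ι, ∀ x, V x ∈ A := by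
  induction d with
  | zero =>
    intro δ hδ
    refine ⟨0, fun ι _ _ _ A hA => ?_⟩
    have hne : ∃ x, x ∈ A := by
      by_contra hcon
      push Not at hcon
      rw [Finset.sum_eq_zero (fun x _ => ind_neg (hcon x))] at hA
      have := K_pos α ι
      nlinarith
    obtain ⟨x, hx⟩ := hne
    exact ⟨⟨fun i => Sum.inl (x i), fun e => e.elim0⟩, fun _ => hx⟩
  | succ d ih =>
    intro δ hδ
    obtain ⟨n1, h1⟩ := h (δ / 2) (by positivity)
    have hK' := K_pos (Option α) (Fin n1)
    obtain ⟨N2, h2⟩ := ih ((δ / 2) / K (Option α) (Fin n1)) (by positivity)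
    refine ⟨n1 + N2, fun ι _ _ hι A hA => ?_⟩
    obtain ⟨n, hn, ⟨e⟩⟩ := exists_split hι
    rw [← sum_words_reindex e, sum_words_sum, Finset.sum_comm, K_congr α e, K_sum,
      ← mul_assoc] at hA
    obtain ⟨l, hl⟩ := avg_line (Y := Fin n → α) δ (h1 (Fin n1) (by simp)) hδ
      (fun x y => Sum.elim x y ∘ e ∈ A) (by simpa [K] using hA)
    obtain ⟨V, hV⟩ := h2 (Fin n) (by simpa using hn) {y | ∀ a, Sum.elim (l a) y ∘ e ∈ A}
      (by simpa [K] using hl)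
    refine ⟨reidx (lineProd l V) e, fun x => ?_⟩
    rw [reidx_apply, lineProd_apply]
    exact hV _ _

/-- Insensitivity of a set of words to changes between `some r` and `none`. -/
def Insens {κ ι : Type} (r : κ) (S : Set (ι → Option κ)) : Prop :=
  ∀ x y, (∀ i, (x i).getD r = (y i).getD r) → x ∈ S → y ∈ S

theorem few_somes {κ : Type} [Fintype κ] [Nonempty κ] (n1 : ℕ) {β : ℝ} (hβ : 0 < β) :
    ∃ N : ℕ, ∀ (ι : Type) [Fintype ι] [DecidableEq ι], N ≤ Fintype.card ι →
      ∑ x : ι → Option κ, ind ((Finset.univ.filter (fun i => (x i).isSome)).card < n1)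
        < β * K (Option κ) ι := by
  set k : ℝ := (Fintype.card κ : ℝ) with hk
  have hk0 : 0 < k := by rw [hk]; exact_mod_cast Fintype.card_pos
  have hlim : Filter.Tendsto (fun n : ℕ => (2 : ℝ) ^ n1 * ((1 + k / 2) / (1 + k)) ^ n)
      Filter.atTop (nhds ((2 : ℝ) ^ n1 * 0)) :=
    (tendsto_pow_atTop_nhds_zero_of_lt_one (by positivity)
      (by rw [div_lt_one (by positivity)]; linarith)).const_mul _
  rw [mul_zero] at hlim
  obtain ⟨N, hN⟩ := Filter.eventually_atTop.1 (hlim.eventually (gt_mem_nhds hβ))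
  refine ⟨N, fun ι _ _ hι => ?_⟩
  have h1 := hN _ hι
  have h2 : ∀ x : ι → Option κ, ind ((Finset.univ.filter (fun i => (x i).isSome)).card < n1) ≤
      2 ^ n1 * ∏ i, (if (x i).isSome then (1 / 2 : ℝ) else 1) := by
    intro x
    rw [Finset.prod_ite]
    simp only [Finset.prod_const, one_pow, mul_one]
    by_cases hx : (Finset.univ.filter (fun i => (x i).isSome)).card < n1
    · rw [ind_pos hx, one_div, inv_pow, ← div_eq_mul_inv, one_le_div (by positivity)]
      exact pow_le_pow_right₀ (by norm_num) hx.le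
    · rw [ind_neg hx]; positivity
  have h3 : ∑ x : ι → Option κ, ∏ i, (if (x i).isSome then (1 / 2 : ℝ) else 1) =
      (1 + k / 2) ^ (Fintype.card ι) := by
    have := Finset.prod_univ_sum (fun _ : ι => (Finset.univ : Finset (Option κ)))
      (fun _ o => if o.isSome then (1 / 2 : ℝ) else 1)
    rw [Fintype.piFinset_univ] at this
    rw [← this]
    simp [Fintype.sum_option, hk, div_eq_mul_inv]
  calc _ ≤ ∑ x : ι → Option κ, 2 ^ n1 * ∏ i, (if (x i).isSome then (1 / 2 : ℝ) else 1) :=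
        Finset.sum_le_sum (fun x _ => h2 x)
    _ = 2 ^ n1 * (1 + k / 2) ^ (Fintype.card ι) := by rw [← Finset.mul_sum, h3]
    _ < β * K (Option κ) ι := by
      have h4 : K (Option κ) ι = (1 + k) ^ (Fintype.card ι) := by
        simp [K, hk, add_comm]
      rw [h4]
      rw [div_pow, ← mul_div_assoc, div_lt_iff₀ (by positivity)] at h1
      exact h1

/-- Word with letters `z` on `F` and `none` elsewhere. -/
def glue {κ ι : Type} [DecidableEq ι] (F : Finset ι) (z : F → κ) : ι → Option κ :=
  fun i => if h : i ∈ F then some (z ⟨i, h⟩) else none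

theorem insens_subspace {κ : Type} [Fintype κ] [Nonempty κ] (h : DHJ κ) (d : ℕ) {β : ℝ}
    (hβ : 0 < β) : ∃ N : ℕ, ∀ (ι : Type) [Fintype ι] [DecidableEq ι], N ≤ Fintype.card ι →
      ∀ (r : κ) (S : Set (ι → Option κ)), Insens r S →
        β * K (Option κ) ι ≤ ∑ x, ind (x ∈ S) →
        ∃ V : Subspace (Fin d) (Option κ) ι, ∀ x, V x ∈ S := by
  obtain ⟨n1, h1⟩ := mdhj h d (β / 2) (by positivity)
  obtain ⟨N, hN⟩ := few_somes (κ := κ) n1 (show 0 < β / 2 by positivity)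
  refine ⟨N, fun ι _ _ hι r S hS hcnt => ?_⟩
  by_contra hcon
  let sm : (ι → Option κ) → Finset ι := fun x => Finset.univ.filter (fun i => (x i).isSome)
  have hfib : ∀ (F : Finset ι) (f : (ι → Option κ) → ℝ),
      ∑ x ∈ Finset.univ.filter (fun x => sm x = F), f x = ∑ z : F → κ, f (glue F z) := by
    classical
    intro F f
    have himg : Finset.univ.filter (fun x => sm x = F) =
        Finset.univ.image (fun z : F → κ => glue F z) := by
      ext x
      simp only [Finset.mem_filter, Finset.mem_univ, true_and, Finset.mem_image]
      constructor
      · rintro rfl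
        refine ⟨fun i => (x i).get (Finset.mem_filter.1 i.2).2, ?_⟩
        funext i
        cases hx : x i <;> simp [glue, sm, hx]
      · rintro ⟨z, rfl⟩
        ext i
        by_cases hi : i ∈ F <;> simp [sm, glue, hi]
    rw [himg, Finset.sum_image]
    intro z _ z' _ hz
    funext i
    have := congrFun hz i
    simpa [glue] using this
  have hF : ∀ F : Finset ι, n1 ≤ F.card →
      ∑ x ∈ Finset.univ.filter (fun x => sm x = F), ind (x ∈ S) ≤
      ∑ x ∈ Finset.univ.filter (fun x => sm x = F), (β / 2) := by
    intro F hFc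
    rw [hfib F (fun x => ind (x ∈ S)), hfib F (fun _ => β / 2), sum_words_const]
    by_contra hlt
    push Not at hlt
    obtain ⟨V, hV⟩ := h1 F (by simpa using hFc) {z | glue F z ∈ S}
      (by rw [mul_comm]; exact hlt.le)
    apply hcon
    refine ⟨⟨fun i => if hi : i ∈ F then (V.idxFun ⟨i, hi⟩).map some id else Sum.inl none, ?_⟩, ?_⟩
    · intro e
      obtain ⟨i, hi⟩ := V.proper e
      exact ⟨i, by simp [hi]⟩
    · intro x
      refine hS _ _ ?_ (hV (fun e => (x e).getD r))
      intro i
      by_cases hi : i ∈ F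
      · cases hv : V.idxFun ⟨i, hi⟩ <;> simp [glue, hi, Subspace.coe_apply, hv]
      · simp [glue, hi, Subspace.coe_apply]
  have hsum : ∑ x, ind (x ∈ S) ≤ ∑ x : ι → Option κ, (β / 2 + ind ((sm x).card < n1)) := by
    rw [← Finset.sum_fiberwise _ sm (fun x => ind (x ∈ S)),
      ← Finset.sum_fiberwise _ sm (fun x => (β / 2 + ind ((sm x).card < n1)))]
    refine Finset.sum_le_sum (fun F _ => ?_)
    by_cases hFc : n1 ≤ F.card
    · refine (hF F hFc).trans (Finset.sum_le_sum (fun x _ => ?_))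
      linarith [ind_nonneg ((sm x).card < n1)]
    · refine Finset.sum_le_sum (fun x hx => ?_)
      have hx' : sm x = F := (Finset.mem_filter.1 hx).2
      rw [ind_pos (show (sm x).card < n1 by rw [hx']; omega)]
      linarith [ind_le_one (x ∈ S)]
  rw [Finset.sum_add_distrib, sum_words_const] at hsum
  have := hN ι hι
  nlinarith

end DHJ
end

noncomputable section
namespace DHJ
open Combinatorics

theorem sum_range_ind {β γ : Type} [Fintype β] [Fintype γ] (f : β → γ)
    (hf : Function.Injective f) (F : γ → ℝ) :
    ∑ x, ind (x ∈ Set.range f) * F x = ∑ z, F (f z) := by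
  classical
  have h1 : ∀ x, ind (x ∈ Set.range f) * F x =
      if x ∈ Finset.univ.image f then F x else 0 := by
    intro x
    by_cases hx : x ∈ Set.range f
    · rw [ind_pos hx, if_pos (by simpa using hx), one_mul]
    · rw [ind_neg hx, if_neg (by simpa using hx), zero_mul]
  rw [Finset.sum_congr rfl (fun x _ => h1 x), ← Finset.sum_filter]
  rw [Finset.filter_mem_eq_inter, Finset.univ_inter, Finset.sum_image (fun _ _ _ _ h => hf h)]

theorem cnt_le_K {α ι : Type} [Fintype α] [Fintype ι] [DecidableEq ι] (p : (ι → α) → Prop) :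
    ∑ x, ind (p x) ≤ K α ι := by
  calc ∑ x, ind (p x) ≤ ∑ _x : ι → α, (1 : ℝ) := Finset.sum_le_sum (fun _ _ => ind_le_one _)
    _ = K α ι := by rw [sum_words_const, mul_one]

theorem insens_sum_step {κ ι1 ι2 : Type} [Fintype κ] [Nonempty κ] [Fintype ι1] [Fintype ι2]
    [DecidableEq ι1] [DecidableEq ι2] (d : ℕ) (r : κ) (b P : ℝ) (hb : 0 ≤ b) (hP : 0 ≤ P)
    (hsub : ∀ S : Set (ι1 → Option κ), Insens r S → b * K (Option κ) ι1 ≤ ∑ x, ind (x ∈ S) →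
      ∃ V : Subspace (Fin d) (Option κ) ι1, ∀ x, V x ∈ S)
    (ih : ∀ S : Set (ι2 → Option κ), Insens r S → ∀ g : (ι2 → Option κ) → ℝ,
      (∀ x, g x ≤ 1) → (∀ V : Subspace (Fin d) (Option κ) ι2, ∑ x, g (V x) ≤ 0) →
      ∑ x, ind (x ∈ S) * g x ≤ b * K (Option κ) ι2 +
        P * (∑ x, ind (x ∈ S) - b * K (Option κ) ι2))
    (S : Set (ι1 ⊕ ι2 → Option κ)) (hS : Insens r S) (g : (ι1 ⊕ ι2 → Option κ) → ℝ)
    (hg : ∀ x, g x ≤ 1)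
    (hV : ∀ V : Subspace (Fin d) (Option κ) (ι1 ⊕ ι2), ∑ x, g (V x) ≤ 0) :
    ∑ x, ind (x ∈ S) * g x ≤ b * K (Option κ) (ι1 ⊕ ι2) +
        P * (1 - 1 / K (Option κ) ι1) * (∑ x, ind (x ∈ S) - b * K (Option κ) (ι1 ⊕ ι2)) := by
  classical
  set K1 := K (Option κ) ι1 with hK1
  set K2 := K (Option κ) ι2 with hK2
  have hK1p : 0 < K1 := K_pos _ _
  have hK2p : 0 < K2 := K_pos _ _
  let sec : (ι2 → Option κ) → Set (ι1 → Option κ) := fun y => {x | Sum.elim x y ∈ S}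
  let Rg : Set (ι1 → Option κ) → Set (ι1 → Option κ) := fun T =>
    if h : Insens r T ∧ b * K1 ≤ ∑ x, ind (x ∈ T) then
      Set.range (fun x => (hsub T h.1 h.2).choose x) else ∅
  have hRg : ∀ T, Rg T ⊆ T := by
    intro T x hx
    by_cases h : Insens r T ∧ b * K1 ≤ ∑ x, ind (x ∈ T)
    · simp only [Rg, dif_pos h] at hx
      obtain ⟨z, rfl⟩ := hx
      exact (hsub T h.1 h.2).choose_spec z
    · simp only [Rg, dif_neg h] at hx
      exact hx.elim
  have hsec : ∀ y, Insens r (sec y) := by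
    intro y x x' hxx' hx
    refine hS _ _ ?_ hx
    intro i
    cases i
    · exact hxx' _
    · rfl
  have hsecy : ∀ y y', (∀ i, (y i).getD r = (y' i).getD r) → sec y = sec y' := by
    intro y y' hyy
    ext x
    constructor
    · refine hS _ _ ?_
      intro i
      cases i
      · rfl
      · exact hyy _
    · refine hS _ _ ?_
      intro i
      cases i
      · rfl
      · exact (hyy _).symm
  let S' : (ι1 → Option κ) → Set (ι2 → Option κ) := fun x =>
    {y | x ∈ sec y ∧ x ∉ Rg (sec y)}
  have hS' : ∀ x, Insens r (S' x) := by
    intro x y y' hyy hy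
    have := hsecy y y' hyy
    change x ∈ sec y' ∧ x ∉ Rg (sec y')
    rw [← this]
    exact hy
  have hsplit : ∀ x y, ind (Sum.elim x y ∈ S) = ind (x ∈ Rg (sec y)) + ind (y ∈ S' x) := by
    intro x y
    by_cases h1 : x ∈ Rg (sec y)
    · have h2 : Sum.elim x y ∈ S := hRg _ h1
      have h3 : y ∉ S' x := fun h => h.2 h1
      rw [ind_pos h1, ind_pos h2, ind_neg h3, add_zero]
    · rw [ind_neg h1, zero_add]
      by_cases h2 : Sum.elim x y ∈ S
      · rw [ind_pos h2, ind_pos (show y ∈ S' x from ⟨h2, h1⟩)]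
      · rw [ind_neg h2, ind_neg (show y ∉ S' x from fun h => h2 h.1)]
  have hrem : ∀ y, 1 / K1 * (∑ x, ind (Sum.elim x y ∈ S) - b * K1) ≤
      ∑ x, ind (x ∈ Rg (sec y)) := by
    intro y
    by_cases h : Insens r (sec y) ∧ b * K1 ≤ ∑ x, ind (x ∈ sec y)
    · have h1 : 1 ≤ ∑ x, ind (x ∈ Rg (sec y)) := by
        have hm : (hsub (sec y) h.1 h.2).choose (fun _ => none) ∈ Rg (sec y) := by
          simp only [Rg, dif_pos h]
          exact ⟨_, rfl⟩
        rw [← ind_pos hm]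
        exact Finset.single_le_sum (f := fun x => ind (x ∈ Rg (sec y)))
          (fun _ _ => ind_nonneg _) (Finset.mem_univ _)
      refine le_trans ?_ h1
      rw [one_div, inv_mul_le_iff₀ hK1p]
      have := cnt_le_K (fun x => Sum.elim x y ∈ S)
      have : 0 ≤ b * K1 := by positivity
      linarith
    · have h2 : ∑ x, ind (x ∈ sec y) < b * K1 := by
        by_contra h3
        exact h ⟨hsec y, not_lt.1 h3⟩
      have h3 : 0 ≤ ∑ x, ind (x ∈ Rg (sec y)) := Finset.sum_nonneg (fun _ _ => ind_nonneg _)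
      refine le_trans ?_ h3
      refine mul_nonpos_of_nonneg_of_nonpos (by positivity) ?_
      have : ∑ x, ind (Sum.elim x y ∈ S) < b * K1 := h2
      linarith
  have hremg : ∀ y, ∑ x, ind (x ∈ Rg (sec y)) * g (Sum.elim x y) ≤ 0 := by
    intro y
    by_cases h : Insens r (sec y) ∧ b * K1 ≤ ∑ x, ind (x ∈ sec y)
    · have he : Rg (sec y) = Set.range (fun x => (hsub (sec y) h.1 h.2).choose x) := by
        simp only [Rg, dif_pos h]
      rw [he, sum_range_ind _ (sub_injective _) (fun x => g (Sum.elim x y))]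
      have := hV (prodPt (hsub (sec y) h.1 h.2).choose y)
      simpa only [prodPt_apply] using this
    · have he : Rg (sec y) = ∅ := by simp only [Rg, dif_neg h]
      rw [he]
      refine le_of_eq (Finset.sum_eq_zero (fun x _ => ?_))
      rw [ind_neg (Set.notMem_empty x), zero_mul]
  have hmain : ∀ x, ∑ y, ind (y ∈ S' x) * g (Sum.elim x y) ≤
      b * K2 + P * (∑ y, ind (y ∈ S' x) - b * K2) := by
    intro x
    refine ih (S' x) (hS' x) (fun y => g (Sum.elim x y)) (fun y => hg _) (fun V => ?_)
    have := hV (ptProd x V)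
    simpa only [ptProd_apply] using this
  have hcS : ∑ x, ind (x ∈ S) = ∑ y, ∑ x, ind (x ∈ Rg (sec y)) + ∑ x, ∑ y, ind (y ∈ S' x) := by
    rw [sum_words_sum, Finset.sum_comm (f := fun y x => ind (x ∈ Rg (sec y))),
      ← Finset.sum_add_distrib]
    refine Finset.sum_congr rfl (fun x _ => ?_)
    rw [← Finset.sum_add_distrib]
    exact Finset.sum_congr rfl (fun y _ => hsplit x y)
  have hcg : ∑ x, ind (x ∈ S) * g x = ∑ y, ∑ x, ind (x ∈ Rg (sec y)) * g (Sum.elim x y) +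
      ∑ x, ∑ y, ind (y ∈ S' x) * g (Sum.elim x y) := by
    rw [sum_words_sum, Finset.sum_comm (f := fun y x => ind (x ∈ Rg (sec y)) * g (Sum.elim x y)),
      ← Finset.sum_add_distrib]
    refine Finset.sum_congr rfl (fun x _ => ?_)
    rw [← Finset.sum_add_distrib]
    refine Finset.sum_congr rfl (fun y _ => ?_)
    rw [hsplit x y, add_mul]
  have hr : 1 / K1 * (∑ x, ind (x ∈ S) - b * (K1 * K2)) ≤
      ∑ y, ∑ x, ind (x ∈ Rg (sec y)) := by
    refine le_trans (le_of_eq ?_) (Finset.sum_le_sum (fun y _ => hrem y))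
    rw [← Finset.mul_sum, Finset.sum_sub_distrib, sum_words_const, sum_words_sum,
      Finset.sum_comm]
    ring
  have hm2 : ∑ x, ∑ y, ind (y ∈ S' x) * g (Sum.elim x y) ≤
      b * (K1 * K2) + P * (∑ x, ∑ y, ind (y ∈ S' x) - b * (K1 * K2)) := by
    refine le_trans (Finset.sum_le_sum (fun x _ => hmain x)) (le_of_eq ?_)
    rw [Finset.sum_add_distrib, sum_words_const, ← Finset.mul_sum, Finset.sum_sub_distrib,
      sum_words_const]
    ring
  have hg0 : ∑ y, ∑ x, ind (x ∈ Rg (sec y)) * g (Sum.elim x y) ≤ 0 :=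
    Finset.sum_nonpos (fun y _ => hremg y)
  rw [hcg, K_sum]
  have h9 : P * (∑ x, ∑ y, ind (y ∈ S' x) - b * (K1 * K2)) ≤
      P * ((1 - 1 / K1) * (∑ x, ind (x ∈ S) - b * (K1 * K2))) := by
    refine mul_le_mul_of_nonneg_left ?_ hP
    linarith
  rw [mul_assoc P]
  linarith

theorem insens_sum {κ : Type} [Fintype κ] [Nonempty κ] (h : DHJ κ) (d : ℕ) {β : ℝ}
    (hβ : 0 < β) : ∃ N : ℕ, ∀ (ι : Type) [Fintype ι] [DecidableEq ι], N ≤ Fintype.card ι →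
      ∀ (r : κ) (S : Set (ι → Option κ)), Insens r S → ∀ g : (ι → Option κ) → ℝ,
      (∀ x, g x ≤ 1) → (∀ V : Subspace (Fin d) (Option κ) ι, ∑ x, g (V x) ≤ 0) →
      ∑ x, ind (x ∈ S) * g x ≤ β * K (Option κ) ι := by
  obtain ⟨m1, hm1⟩ := insens_subspace h d (show 0 < β / 2 by positivity)
  have hK := one_le_K (Option κ) (Fin m1)
  set q := 1 / K (Option κ) (Fin m1) with hq
  have hq0 : 0 < q := by positivity
  have hq1 : q ≤ 1 := by rw [hq, div_le_one (by positivity)]; exact hK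
  have claim : ∀ j : ℕ, ∀ (ι : Type) [Fintype ι] [DecidableEq ι], j * m1 ≤ Fintype.card ι →
      ∀ (r : κ) (S : Set (ι → Option κ)), Insens r S → ∀ g : (ι → Option κ) → ℝ,
      (∀ x, g x ≤ 1) → (∀ V : Subspace (Fin d) (Option κ) ι, ∑ x, g (V x) ≤ 0) →
      ∑ x, ind (x ∈ S) * g x ≤ β / 2 * K (Option κ) ι +
        (1 - q) ^ j * (∑ x, ind (x ∈ S) - β / 2 * K (Option κ) ι) := by
    intro j
    induction j with
    | zero =>
      intro ι _ _ _ r S _ g hg _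
      rw [pow_zero, one_mul, add_sub_cancel]
      refine Finset.sum_le_sum (fun x _ => ?_)
      nlinarith [hg x, ind_nonneg (x ∈ S)]
    | succ j ih =>
      intro ι _ _ hι r S hS g hg hV
      obtain ⟨n, hn, ⟨e⟩⟩ := exists_split (a := m1) (b := j * m1) (ι := ι)
        (by rw [add_mul] at hι; omega)
      have := insens_sum_step (ι1 := Fin m1) (ι2 := Fin n) d r (β / 2) ((1 - q) ^ j)
        (by positivity) (pow_nonneg (by linarith) _)
        (fun S hS => hm1 (Fin m1) (by simp) r S hS)
        (fun S hS => ih (Fin n) (by simpa using hn) r S hS)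
        {x | x ∘ e ∈ S} (fun x y hxy hx => hS _ _ (fun i => hxy (e i)) hx)
        (fun x => g (x ∘ e)) (fun x => hg _) (fun V => by
          have := hV (reidx V e)
          simpa only [reidx_apply] using this)
      have e1 := sum_words_reindex e (fun x => ind (x ∈ S) * g x)
      have e2 := sum_words_reindex e (fun x => ind (x ∈ S))
      rw [← e1, ← e2, K_congr _ e, pow_succ]
      exact this
  obtain ⟨j, hj⟩ := exists_pow_lt_of_lt_one (show 0 < β / 2 by positivity)
    (show 1 - q < 1 by linarith)
  refine ⟨j * m1, fun ι _ _ hι r S hS g hg hV => ?_⟩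
  have h1 := claim j ι hι r S hS g hg hV
  have h2 := cnt_le_K (fun x => x ∈ S)
  have h3 : 0 ≤ (1 - q) ^ j := pow_nonneg (by linarith) _
  have h4 := K_pos (Option κ) ι
  have h5 : (1 - q) ^ j * (∑ x, ind (x ∈ S) - β / 2 * K (Option κ) ι) ≤
      (1 - q) ^ j * K (Option κ) ι := by
    refine mul_le_mul_of_nonneg_left ?_ h3
    have : 0 ≤ β / 2 * K (Option κ) ι := by positivity
    linarith
  nlinarith

theorem insens_inter_sum {κ : Type} [Fintype κ] [Nonempty κ] (h : DHJ κ) (d : ℕ)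
    (s : Finset κ) : ∀ β : ℝ, 0 < β →
    ∃ N : ℕ, ∀ (ι : Type) [Fintype ι] [DecidableEq ι], N ≤ Fintype.card ι →
      ∀ (D : κ → Set (ι → Option κ)), (∀ r, Insens r (D r)) → ∀ g : (ι → Option κ) → ℝ,
      (∀ x, g x ≤ 1) → (∀ V : Subspace (Fin d) (Option κ) ι, ∑ x, g (V x) ≤ 0) →
      ∑ x, ind (∀ r ∈ s, x ∈ D r) * g x ≤ β * K (Option κ) ι := by
  classical
  induction s using Finset.induction_on with
  | empty =>
    intro β hβ
    obtain ⟨N, hN⟩ := insens_sum h d hβ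
    refine ⟨N, fun ι _ _ hι D hD g hg hV => ?_⟩
    obtain ⟨r⟩ := ‹Nonempty κ›
    have := hN ι hι r Set.univ (fun _ _ _ _ => trivial) g hg hV
    simpa using this
  | insert r s hrs ih =>
    intro β hβ
    obtain ⟨d', hd'⟩ := ih (β / 2) (by positivity)
    obtain ⟨N, hN⟩ := insens_sum h d' (show 0 < β / 2 by positivity)
    refine ⟨N, fun ι _ _ hι D hD g hg hV => ?_⟩
    have h1 := hN ι hι r (D r) (hD r) (fun x => ind (∀ r ∈ s, x ∈ D r) * g x - β / 2)
      (fun x => by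
        have := hg x
        have h0 := ind_nonneg (∀ r ∈ s, x ∈ D r)
        have h1 := ind_le_one (∀ r ∈ s, x ∈ D r)
        nlinarith)
      (fun V => by
        rw [Finset.sum_sub_distrib, sum_words_const]
        have := hd' (Fin d') (by simp) (fun r => {x | V x ∈ D r}) (fun r' x y hxy hx => by
            refine hD r' _ _ (fun i => ?_) hx
            cases hi : V.idxFun i with
            | inl a => simp [Subspace.coe_apply, hi]
            | inr e => simpa [Subspace.coe_apply, hi] using hxy e)
          (fun x => g (V x)) (fun x => hg _) (fun U => by
            have := hV (comp V U)
            simpa only [comp_apply] using this)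
        have h2 : ∑ x, ind (∀ r ∈ s, V x ∈ D r) * g (V x) ≤ β / 2 * K (Option κ) (Fin d') := this
        linarith)
    have h2 : ∀ x, ind (∀ r' ∈ insert r s, x ∈ D r') * g x =
        ind (x ∈ D r) * (ind (∀ r ∈ s, x ∈ D r) * g x - β / 2) + β / 2 * ind (x ∈ D r) := by
      intro x
      have h3 : ind (∀ r' ∈ insert r s, x ∈ D r') =
          ind (x ∈ D r) * ind (∀ r ∈ s, x ∈ D r) := by
        rw [Finset.forall_mem_insert]
        by_cases ha : x ∈ D r <;> by_cases hb : ∀ r ∈ s, x ∈ D r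
        · rw [ind_pos ha, ind_pos hb, ind_pos ⟨ha, hb⟩, one_mul]
        · rw [ind_neg hb, ind_neg (fun h => hb h.2), mul_zero]
        · rw [ind_neg ha, ind_neg (fun h => ha h.1), zero_mul]
        · rw [ind_neg ha, ind_neg (fun h => ha h.1), zero_mul]
      rw [h3]
      ring
    rw [Finset.sum_congr rfl (fun x _ => h2 x), Finset.sum_add_distrib, ← Finset.mul_sum]
    have h4 := cnt_le_K (fun x => x ∈ D r)
    nlinarith

end DHJ
end

noncomputable section
namespace DHJ
open Combinatorics

/-! ### The density increment -/

/-- Sets of words containing no combinatorial line. -/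
def LF {α ι : Type} (A : Set (ι → α)) : Prop := ¬ ∃ l : Line α ι, ∀ a, l a ∈ A

/-- Line-free sets in high dimension have density at most `c`. -/
def EB (α : Type) [Fintype α] (c : ℝ) : Prop :=
  ∃ N : ℕ, ∀ (ι : Type) [Fintype ι] [DecidableEq ι], N ≤ Fintype.card ι →
    ∀ A : Set (ι → α), LF A → ∑ x, ind (x ∈ A) ≤ c * K α ι

theorem exists_critical {α : Type} [Fintype α] [Nonempty α] (h : ¬ DHJ α) :
    ∃ c : ℝ, 0 < c ∧ (∀ c', c < c' → EB α c') ∧ (∀ c', c' < c → ¬ EB α c') := by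
  unfold DHJ at h
  push Not at h
  obtain ⟨δ, hδ, h⟩ := h
  have h1 : ∀ e, EB α e → δ ≤ e := by
    rintro e ⟨N, hN⟩
    obtain ⟨ι, hf, hd, hc, A, hA, hl⟩ := h N
    have := hN ι hc A (by unfold LF; push Not; exact hl)
    exact le_of_mul_le_mul_right (hA.trans this) (K_pos α ι)
  have h2 : EB α 1 := ⟨0, fun ι _ _ _ A _ => by rw [one_mul]; exact cnt_le_K _⟩
  have hb : BddBelow {e | EB α e} := ⟨δ, fun e he => h1 e he⟩
  refine ⟨sInf {e | EB α e}, lt_of_lt_of_le hδ (le_csInf ⟨1, h2⟩ h1), fun c' hc' => ?_,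
    fun c' hc' hE => ?_⟩
  · obtain ⟨e, he, hlt⟩ := exists_lt_of_csInf_lt ⟨1, h2⟩ hc'
    obtain ⟨N, hN⟩ := he
    refine ⟨N, fun ι _ _ hc A hA => (hN ι hc A hA).trans ?_⟩
    exact mul_le_mul_of_nonneg_right hlt.le (K_nonneg α ι)
  · exact absurd (csInf_le hb hE) (not_le.2 hc')

theorem LF_sub {η α ι : Type} {A : Set (ι → α)} (h : LF A) (V : Subspace η α ι) :
    LF {x | V x ∈ A} := by
  rintro ⟨l, hl⟩
  exact h ⟨mapLine V l, fun a => by rw [mapLine_apply]; exact hl a⟩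

theorem not_EB {α : Type} [Fintype α] {c : ℝ} (h : ¬ EB α c) (ιM : Type) [Fintype ιM]
    [DecidableEq ιM] (N : ℕ) : ∃ n, N ≤ n ∧ ∃ B : Set (ιM ⊕ Fin n → α), LF B ∧
      c * K α (ιM ⊕ Fin n) < ∑ x, ind (x ∈ B) := by
  unfold EB at h
  push Not at h
  obtain ⟨ι, hf, hd, hc, A, hA, hl⟩ := h (Fintype.card ιM + N)
  obtain ⟨n, hn, ⟨e⟩⟩ := exists_split hc
  let e' : ι ≃ ιM ⊕ Fin n := e.trans (Equiv.sumCongr (Fintype.equivFin ιM).symm (Equiv.refl _))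
  refine ⟨n, hn, {x | x ∘ e' ∈ A}, ?_, ?_⟩
  · rintro ⟨l, hl⟩
    exact hA ⟨reLine l e', fun a => by rw [reLine_apply]; exact hl a⟩
  · rw [← K_congr α e']
    refine hl.trans_eq ?_
    exact (sum_words_reindex e' (fun x => ind (x ∈ A))).symm

/-- Replace `none` by `some r`. -/
def sub {κ ι : Type} (r : κ) (x : ι → Option κ) : ι → Option κ := fun i => some ((x i).getD r)

theorem ext_sub {κ η ι : Type} (V : Subspace η κ ι) (r : κ) (x : η → Option κ) :
    sub r (ext V x) = ext V (sub r x) := by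
  funext i
  cases h : V.idxFun i <;> simp [Subspace.coe_apply, ext, h, sub]

theorem upper {κ ι : Type} [Fintype κ] [Fintype ι] [DecidableEq ι] (A : Set (ι → Option κ))
    (hA : LF A) {c β : ℝ} {d : ℕ} (hc : 0 ≤ c)
    (hins : ∀ (D : κ → Set (ι → Option κ)), (∀ r, Insens r (D r)) → ∀ g : (ι → Option κ) → ℝ,
      (∀ x, g x ≤ 1) → (∀ V : Subspace (Fin d) (Option κ) ι, ∑ x, g (V x) ≤ 0) →
      ∑ x, ind (∀ r ∈ (Finset.univ : Finset κ), x ∈ D r) * g x ≤ β * K (Option κ) ι)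
    (hV : ∀ V : Subspace (Fin d) (Option κ) ι,
      ∑ x, ind (V x ∈ A) ≤ c * K (Option κ) (Fin d)) (hβ : 0 ≤ β) :
    ∑ x, ind (x ∈ A) ≤ c * (K (Option κ) ι - ∑ x, ind (∀ r, sub r x ∈ A))
      + 2 ^ (Fintype.card κ) * (β * K (Option κ) ι) + K κ ι := by
  classical
  let D : Finset κ → κ → Set (ι → Option κ) := fun T r => {x | sub r x ∈ A ↔ r ∈ T}
  have hD : ∀ T r, Insens r (D T r) := by
    intro T r x y hxy hx
    have : sub r x = sub r y := by funext i; simp [sub, hxy i]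
    simp only [D, Set.mem_setOf_eq] at hx ⊢
    rwa [← this]
  have h1 : ∀ T, ∑ x, ind (∀ r ∈ (Finset.univ : Finset κ), x ∈ D T r) * (ind (x ∈ A) - c)
      ≤ β * K (Option κ) ι := by
    intro T
    refine hins (D T) (hD T) (fun x => ind (x ∈ A) - c) (fun x => ?_) (fun V => ?_)
    · have := ind_le_one (x ∈ A)
      linarith
    · rw [Finset.sum_sub_distrib, sum_words_const]
      have := hV V
      linarith
  have h2 : ∀ x : ι → Option κ, ind (x ∈ A) ≤
      c * (1 - ind (∀ r, sub r x ∈ A)) +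
      ∑ T ∈ (Finset.univ : Finset (Finset κ)).erase Finset.univ,
        ind (∀ r ∈ (Finset.univ : Finset κ), x ∈ D T r) * (ind (x ∈ A) - c)
      + ind (∀ i, x i ≠ none) := by
    intro x
    have key : ∀ T, (∀ r ∈ (Finset.univ : Finset κ), x ∈ D T r) ↔
        T = Finset.univ.filter (fun r => sub r x ∈ A) := by
      intro T
      constructor
      · intro h
        ext r
        have := h r (Finset.mem_univ _)
        simp only [D, Set.mem_setOf_eq] at this
        simp [this]
      · rintro rfl r -
        simp [D]
    by_cases hS : ∀ r, sub r x ∈ A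
    · rw [ind_pos hS, Finset.sum_eq_zero]
      · have : ind (x ∈ A) ≤ ind (∀ i, x i ≠ none) := by
          refine ind_mono (fun hx => ?_)
          by_contra hcon
          push Not at hcon
          refine hA ⟨⟨fun i => (x i).map some, ?_⟩, fun a => ?_⟩
          · obtain ⟨i, hi⟩ := hcon
            exact ⟨i, by simp [hi]⟩
          · cases a with
            | none =>
              convert hx using 1
              funext i
              cases h : x i <;> simp [h]
            | some r =>
              convert hS r using 1
              funext i
              cases h : x i <;> simp [h, sub]
        linarith
      · intro T hT
        rw [ind_neg, zero_mul]
        rw [key]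
        intro h
        refine (Finset.mem_erase.1 hT).1 ?_
        rw [h]
        simp [hS]
    · rw [ind_neg hS, Finset.sum_eq_single (Finset.univ.filter (fun r => sub r x ∈ A))]
      · rw [ind_pos ((key _).2 rfl)]
        have := ind_nonneg (∀ i, x i ≠ none)
        linarith
      · intro T _ hT
        rw [ind_neg, zero_mul]
        rwa [key]
      · intro h
        exfalso
        apply h
        refine Finset.mem_erase.2 ⟨?_, Finset.mem_univ _⟩
        intro h
        apply hS
        intro r
        have := Finset.mem_univ r
        rw [← h] at this
        simpa using this
  have h3 : ∑ x : ι → Option κ, ind (∀ i, x i ≠ none) ≤ K κ ι := by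
    have : ∑ x : ι → Option κ, ind (∀ i, x i ≠ none) =
        ∑ x ∈ Finset.univ.image (fun z : ι → κ => (fun i => some (z i))), (1 : ℝ) := by
      rw [← Finset.sum_subset (Finset.subset_univ
        (Finset.univ.image (fun z : ι → κ => (fun i => some (z i)))))]
      · refine Finset.sum_congr rfl (fun x hx => ind_pos ?_)
        obtain ⟨z, -, rfl⟩ := Finset.mem_image.1 hx
        simp
      · intro x _ hx
        refine ind_neg (fun h => hx ?_)
        refine Finset.mem_image.2 ⟨fun i => (x i).get (Option.isSome_iff_ne_none.2 (h i)),
          Finset.mem_univ _, ?_⟩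
        funext i
        simp
    rw [this, Finset.sum_const, nsmul_eq_mul, mul_one]
    have h4 := Finset.card_image_le (s := Finset.univ)
      (f := (fun z : ι → κ => (fun i => some (z i))))
    have h5 : K κ ι = ((Finset.univ : Finset (ι → κ)).card : ℝ) := by simp [K]
    rw [h5]
    exact_mod_cast h4
  have h6 := Finset.sum_le_sum (fun x (_ : x ∈ (Finset.univ : Finset (ι → Option κ))) => h2 x)
  rw [Finset.sum_add_distrib, Finset.sum_add_distrib, ← Finset.mul_sum, Finset.sum_sub_distrib,
    sum_words_const, mul_one, Finset.sum_comm] at h6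
  have h7 : ∑ T ∈ (Finset.univ : Finset (Finset κ)).erase Finset.univ, ∑ x,
      ind (∀ r ∈ (Finset.univ : Finset κ), x ∈ D T r) * (ind (x ∈ A) - c) ≤
      2 ^ (Fintype.card κ) * (β * K (Option κ) ι) := by
    refine (Finset.sum_le_sum (fun T _ => h1 T)).trans ?_
    rw [Finset.sum_const, nsmul_eq_mul]
    refine mul_le_mul_of_nonneg_right ?_ (mul_nonneg hβ (K_nonneg _ _))
    have : ((Finset.univ : Finset (Finset κ)).erase Finset.univ).card ≤ 2 ^ (Fintype.card κ) := by
      refine (Finset.card_le_card (Finset.erase_subset _ _)).trans ?_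
      simp
    exact_mod_cast this
  linarith

theorem pick {Y : Type} [Fintype Y] [Nonempty Y] (a s : Y → ℝ) {c ε1 ε2 η θ : ℝ}
    (hη : 0 < η) (hθ : 0 < θ) (hε1 : 0 ≤ ε1) (ha : ∀ y, a y ≤ c + ε1) (hs1 : ∀ y, s y ≤ 1)
    (hs : θ * Fintype.card Y ≤ ∑ y, s y) (hA : (c - ε2) * Fintype.card Y ≤ ∑ y, a y)
    (hε : ε1 + ε2 ≤ η * θ / 2) : ∃ y, θ / 2 ≤ s y ∧ c - η ≤ a y := by
  have h1 : ∃ y, c + ε1 + η * θ / 2 ≤ η * s y + a y := by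
    by_contra hcon
    push Not at hcon
    have h2 : ∑ y, (η * s y + a y) < ∑ _y : Y, (c + ε1 + η * θ / 2) :=
      Finset.sum_lt_sum_of_nonempty Finset.univ_nonempty (fun y _ => hcon y)
    rw [Finset.sum_add_distrib, ← Finset.mul_sum, Finset.sum_const, nsmul_eq_mul,
      Finset.card_univ] at h2
    have hY : (0 : ℝ) < Fintype.card Y := by exact_mod_cast Fintype.card_pos
    nlinarith [mul_le_mul_of_nonneg_left hs hη.le, mul_le_mul_of_nonneg_right hε hY.le]
  obtain ⟨y, hy⟩ := h1
  refine ⟨y, ?_, ?_⟩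
  · have := ha y
    have h3 : η * (θ / 2) ≤ η * s y := by linarith
    exact le_of_mul_le_mul_left h3 hη
  · have := mul_le_mul_of_nonneg_left (hs1 y) hη.le
    have := mul_pos hη hθ
    linarith

theorem all_large {Y : Type} [Fintype Y] (f : Y → ℝ) {c ε : ℝ}
    (hf : ∀ y, f y ≤ c + ε) (hs : (c - ε) * Fintype.card Y ≤ ∑ y, f y) (hε : 0 ≤ ε) (y : Y) :
    c - 2 * ε * Fintype.card Y ≤ f y := by
  classical
  rw [← Finset.add_sum_erase _ _ (Finset.mem_univ y)] at hs
  have h1 : ∑ x ∈ Finset.univ.erase y, f x ≤ ∑ x ∈ Finset.univ.erase y, (c + ε) :=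
    Finset.sum_le_sum (fun x _ => hf x)
  rw [Finset.sum_const, nsmul_eq_mul, Finset.card_erase_of_mem (Finset.mem_univ y),
    Nat.cast_sub (Finset.card_pos.2 ⟨y, Finset.mem_univ y⟩), Finset.card_univ] at h1
  push_cast at h1
  linarith

theorem small_pow (κ : Type) [Fintype κ] {β : ℝ} (hβ : 0 < β) : ∃ m0 : ℕ, ∀ m, m0 ≤ m →
    K κ (Fin m) ≤ β * K (Option κ) (Fin m) := by
  let q : ℝ := Fintype.card κ / (Fintype.card κ + 1)
  have hp : (0 : ℝ) < Fintype.card κ + 1 := by positivity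
  have hq0 : 0 ≤ q := by positivity
  have hq1 : q < 1 := by
    rw [div_lt_one hp]
    linarith
  obtain ⟨m0, hm0⟩ := exists_pow_lt_of_lt_one hβ hq1
  refine ⟨m0, fun m hm => ?_⟩
  have h1 : q ^ m ≤ β := (pow_le_pow_of_le_one hq0 hq1.le hm).trans hm0.le
  have h2 : K κ (Fin m) = q ^ m * K (Option κ) (Fin m) := by
    simp only [K, Fintype.card_fin, Fintype.card_option, q, div_pow]
    push_cast
    field_simp
  rw [h2]
  exact mul_le_mul_of_nonneg_right h1 (K_nonneg _ _)

end DHJ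
end

noncomputable section
namespace DHJ
open Combinatorics

theorem card_words (α ι : Type) [Fintype α] [Fintype ι] [DecidableEq ι] :
    (Fintype.card (ι → α) : ℝ) = K α ι := by simp [K]

theorem dhj_step {κ : Type} [Fintype κ] [Nonempty κ] (h : DHJ κ) : DHJ (Option κ) := by
  classical
  by_contra hno
  obtain ⟨c, hc, hup, hlow⟩ := exists_critical hno
  obtain ⟨m0, hm0⟩ := h (c / 2 / 2) (by positivity)
  have hK0 := K_pos (Option κ) (Fin m0)
  have hK01 := one_le_K (Option κ) (Fin m0)
  obtain ⟨θ, hθdef⟩ : ∃ θ, θ = (c / 2 / 2) / K (Option κ) (Fin m0) := ⟨_, rfl⟩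
  have hθ : 0 < θ := by rw [hθdef]; positivity
  have hθc : θ ≤ c / 2 := by
    rw [hθdef]
    refine (div_le_self (by positivity) hK01).trans (by linarith)
  have hcθ : 0 < c * θ := by positivity
  obtain ⟨d, hd⟩ := hup (c + c * θ / 16) (by linarith)
  obtain ⟨N, hN⟩ := insens_inter_sum h d Finset.univ
    (c * θ / 16 / 2 ^ (Fintype.card κ)) (by positivity)
  obtain ⟨η, hηdef⟩ : ∃ η, η = c * θ / 16 := ⟨_, rfl⟩
  have hη : 0 < η := by rw [hηdef]; positivity
  have hηθ : 0 < η * θ := by positivity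
  obtain ⟨N1, hN1⟩ := hup (c + η * θ / 4) (by linarith)
  obtain ⟨N2, hN2⟩ := small_pow κ (β := c * θ / 16) (by positivity)
  obtain ⟨m, hmdef⟩ : ∃ m, m = N + N1 + N2 := ⟨_, rfl⟩
  obtain ⟨ιM, hf, hGR⟩ := graham_rothschild κ m0 m
  have hKM := K_pos (Option κ) ιM
  obtain ⟨ε2, hε2def⟩ : ∃ ε2, ε2 = min (c / 2) (η * θ / 4) := ⟨_, rfl⟩
  have hε2 : 0 < ε2 := by rw [hε2def]; exact lt_min (by positivity) (by positivity)
  have hε2a : ε2 ≤ c / 2 := by rw [hε2def]; exact min_le_left _ _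
  have hε2b : ε2 ≤ η * θ / 4 := by rw [hε2def]; exact min_le_right _ _
  obtain ⟨ε, hεdef⟩ : ∃ ε, ε = ε2 / (2 * K (Option κ) ιM) := ⟨_, rfl⟩
  have hε : 0 < ε := by rw [hεdef]; positivity
  have hεK : 2 * ε * K (Option κ) ιM = ε2 := by rw [hεdef]; field_simp
  obtain ⟨Nn, hNn⟩ := hup (c + ε) (by linarith)
  obtain ⟨n, hn, A, hA, hAd⟩ := not_EB (hlow (c - ε) (by linarith)) ιM Nn
  have hKn := K_pos (Option κ) (Fin n)
  have hsec : ∀ x : ιM → Option κ,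
      (c - ε2) * K (Option κ) (Fin n) ≤ ∑ y : Fin n → Option κ, ind (Sum.elim x y ∈ A) := by
    intro x
    have h1 := all_large (c := c) (ε := ε) (fun x : ιM → Option κ =>
      (∑ y : Fin n → Option κ, ind (Sum.elim x y ∈ A)) / K (Option κ) (Fin n)) ?_ ?_ hε.le x
    · rw [card_words, hεK, le_div_iff₀ hKn] at h1
      exact h1
    · intro x
      rw [div_le_iff₀ hKn]
      refine hNn (Fin n) (by simpa using hn) {y | Sum.elim x y ∈ A} ?_
      rintro ⟨l, hl⟩
      refine hA ⟨⟨Sum.elim (fun i => some (x i)) l.idxFun, ?_⟩, fun a => ?_⟩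
      · obtain ⟨i, hi⟩ := l.proper
        exact ⟨Sum.inr i, hi⟩
      · have h0 : Sum.elim x (l a) ∈ A := hl a
        convert h0 using 1
        funext i
        cases i <;> simp [Line.coe_apply]
    · rw [card_words, ← Finset.sum_div, le_div_iff₀ hKn]
      rw [K_sum, sum_words_sum] at hAd
      linarith
  have hsec2 : ∀ x : ιM → Option κ,
      (c / 2) * K (Option κ) (Fin n) ≤ ∑ y : Fin n → Option κ, ind (Sum.elim x y ∈ A) := by
    intro x
    refine le_trans ?_ (hsec x)
    exact mul_le_mul_of_nonneg_right (by linarith) hKn.le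
  obtain ⟨W, hW⟩ := hGR (fun w => θ * K (Option κ) (Fin n) ≤
    ∑ y : Fin n → Option κ, ind (∀ r, Sum.elim (sub r w) y ∈ A)) (by
    intro U
    obtain ⟨l, hl⟩ := avg_line (α := κ) (ι := Fin m0) (Y := Fin n → Option κ) (c / 2)
      (hm0 (Fin m0) (by simp)) (by positivity) (fun x y => Sum.elim (some ∘ U x) y ∈ A) (by
        rw [Finset.sum_comm, card_words]
        refine le_trans ?_ (Finset.sum_le_sum (fun x _ => hsec2 (some ∘ U x)))
        rw [sum_words_const]
        exact le_of_eq (by ring))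
    refine ⟨l.idxFun, l.proper, ?_⟩
    rw [card_words, ← hθdef] at hl
    refine hl.trans (le_of_eq ?_)
    refine Finset.sum_congr rfl (fun y _ => ?_)
    congr 1
    refine propext (forall_congr' fun r => ?_)
    rw [ext_sub, ← ext_some]
    rfl)
  have hW' : ∀ z : Fin m → Option κ, θ * K (Option κ) (Fin n) ≤
      ∑ y : Fin n → Option κ, ind (∀ r, Sum.elim (ext W (sub r z)) y ∈ A) := by
    intro z
    by_cases hz : ∃ e, z e = none
    · have := hW z hz
      simpa only [ext_sub] using this
    · push Not at hz
      have hz' : ∀ r, sub r z = z := by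
        intro r
        funext e
        obtain ⟨a, ha⟩ := Option.ne_none_iff_exists'.1 (hz e)
        simp [sub, ha]
      refine (mul_le_mul_of_nonneg_right hθc hKn.le).trans ((hsec2 (ext W z)).trans ?_)
      refine Finset.sum_le_sum (fun y _ => ind_mono (fun hy r => ?_))
      rwa [hz' r]
  have hKm := K_pos (Option κ) (Fin m)
  obtain ⟨y, hy1, hy2⟩ := pick (Y := Fin n → Option κ)
    (fun y => (∑ z : Fin m → Option κ, ind (Sum.elim (ext W z) y ∈ A)) / K (Option κ) (Fin m))
    (fun y => (∑ z : Fin m → Option κ, ind (∀ r, Sum.elim (ext W (sub r z)) y ∈ A)) /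
      K (Option κ) (Fin m)) (c := c) (ε1 := η * θ / 4) (ε2 := ε2) hη hθ (by positivity)
    (by
      intro y
      rw [div_le_iff₀ hKm]
      refine hN1 (Fin m) (by simp; omega) {z | Sum.elim (ext W z) y ∈ A} ?_
      have := LF_sub hA (prodPt (ext W) y)
      simpa only [prodPt_apply] using this)
    (by
      intro y
      rw [div_le_one hKm]
      exact cnt_le_K _)
    (by
      rw [card_words, ← Finset.sum_div, le_div_iff₀ hKm, Finset.sum_comm]
      refine le_trans ?_ (Finset.sum_le_sum (fun z _ => hW' z))
      rw [sum_words_const]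
      exact le_of_eq (by ring))
    (by
      rw [card_words, ← Finset.sum_div, le_div_iff₀ hKm, Finset.sum_comm]
      refine le_trans ?_ (Finset.sum_le_sum (fun z _ => hsec (ext W z)))
      rw [sum_words_const]
      exact le_of_eq (by ring))
    (by linarith)
  rw [le_div_iff₀ hKm] at hy1 hy2
  have hLF : LF {z | Sum.elim (ext W z) y ∈ A} := by
    have := LF_sub hA (prodPt (ext W) y)
    simpa only [prodPt_apply] using this
  have hfin := upper (κ := κ) (ι := Fin m) {z | Sum.elim (ext W z) y ∈ A} hLF
    (c := c + c * θ / 16) (β := c * θ / 16 / 2 ^ (Fintype.card κ)) (d := d) (by positivity)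
    (hN (Fin m) (by simp; omega))
    (fun V => hd (Fin d) (by simp) _ (LF_sub hLF V)) (by positivity)
  have h2 : 2 ^ (Fintype.card κ) * (c * θ / 16 / 2 ^ (Fintype.card κ) * K (Option κ) (Fin m))
    = c * θ / 16 * K (Option κ) (Fin m) := by field_simp
  rw [h2] at hfin
  have h3 := hN2 m (by omega)
  have hfin' := hy2.trans hfin
  have h4 : (c + c * θ / 16) * (θ / 2 * K (Option κ) (Fin m)) ≤ (c + c * θ / 16) *
    ∑ z : Fin m → Option κ, ind (∀ r, Sum.elim (ext W (sub r z)) y ∈ A) :=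
    mul_le_mul_of_nonneg_left hy1 (by positivity)
  have h5 : (∑ z : Fin m → Option κ,
    ind (∀ r, sub r z ∈ {z | Sum.elim (ext W z) y ∈ A})) =
    ∑ z : Fin m → Option κ, ind (∀ r, Sum.elim (ext W (sub r z)) y ∈ A) := rfl
  rw [h5] at hfin'
  have h6 : 0 < c * θ * K (Option κ) (Fin m) := by positivity
  have h7 : 0 < c * θ * θ * K (Option κ) (Fin m) := by positivity
  rw [hηdef] at hfin'
  nlinarith

theorem dhj_equiv {α β : Type} [Fintype α] [Fintype β] (e : α ≃ β) (h : DHJ α) : DHJ β := by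
  intro δ hδ
  obtain ⟨N, hN⟩ := h δ hδ
  refine ⟨N, fun ι _ _ hι A hA => ?_⟩
  have hK : K α ι = K β ι := by simp [K, Fintype.card_congr e]
  obtain ⟨l, hl⟩ := hN ι hι {x | (fun i => e (x i)) ∈ A} (by
    rw [hK]
    refine hA.trans (le_of_eq ?_)
    exact (Equiv.sum_comp (Equiv.arrowCongr (Equiv.refl ι) e) (fun x => ind (x ∈ A))).symm)
  refine ⟨l.map e, fun a => ?_⟩
  have := hl (e.symm a)
  simp only [Set.mem_setOf_eq] at this
  convert this using 1
  funext i
  cases h : l.idxFun i <;> simp [Line.map, Line.coe_apply, h]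

theorem dhj_fin (k : ℕ) : DHJ (Fin (k + 1)) := by
  induction k with
  | zero =>
    intro δ hδ
    refine ⟨1, fun ι _ _ hι A hA => ?_⟩
    have hne : ∃ x, x ∈ A := by
      by_contra hcon
      push Not at hcon
      rw [Finset.sum_eq_zero (fun x _ => ind_neg (hcon x))] at hA
      have := K_pos (Fin (0 + 1)) ι
      nlinarith
    obtain ⟨x, hx⟩ := hne
    have : Nonempty ι := Fintype.card_pos_iff.1 hι
    refine ⟨Line.diagonal _ ι, fun a => ?_⟩
    convert hx using 1
    funext i
    exact Fin.ext (by have h1 := (x i).isLt; have h2 := (Line.diagonal (Fin (0 + 1)) ι a i).isLt; omega)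
  | succ k ih => exact dhj_equiv (finSuccEquiv (k + 1)).symm (dhj_step ih)

theorem dhj_option (k : ℕ) : DHJ (Option (Fin k)) := dhj_equiv (finSuccEquiv k) (dhj_fin k)

end DHJ
end

noncomputable section
namespace DHJ
open Combinatorics

/-! ### Recurrence -/

/-- The transformation attached to a letter. -/
def letter {X : Type*} {k : ℕ} (T : Fin k → ℕ → X → X) (o : Option (Fin k)) (t : ℕ) : X → X :=
  match o with
  | none => id
  | some j => T j t

/-- The transformation attached to a word along a list of indices. -/
def word {X : Type*} {k : ℕ} (T : Fin k → ℕ → X → X) (w : ℕ → Option (Fin k)) :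
    List ℕ → X → X
  | [] => id
  | t :: L => letter T (w t) t ∘ word T w L

section
variable {X : Type*} {k : ℕ} {T : Fin k → ℕ → X → X}

theorem letter_comm (hcomm : ∀ i j m n, T i m ∘ T j n = T j n ∘ T i m)
    (o o' : Option (Fin k)) (t t' : ℕ) :
    letter T o t ∘ letter T o' t' = letter T o' t' ∘ letter T o t := by
  cases o <;> cases o' <;> first | rfl | exact hcomm _ _ _ _

theorem word_comm (hcomm : ∀ i j m n, T i m ∘ T j n = T j n ∘ T i m)
    (o : Option (Fin k)) (t : ℕ) (w : ℕ → Option (Fin k)) (L : List ℕ) :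
    letter T o t ∘ word T w L = word T w L ∘ letter T o t := by
  induction L with
  | nil => rfl
  | cons s L ih =>
    simp only [word]
    rw [← Function.comp_assoc, letter_comm hcomm, Function.comp_assoc, ih, Function.comp_assoc]

theorem word_split (hcomm : ∀ i j m n, T i m ∘ T j n = T j n ∘ T i m)
    (idx : ℕ → Option (Option (Fin k))) (a : Option (Fin k)) (L : List ℕ) :
    word T (fun t => (idx t).getD a) L =
      word T (fun _ => a) (L.filter (fun t => (idx t).isNone)) ∘
        word T (fun t => (idx t).getD none) L := by
  induction L with
  | nil => rfl
  | cons t L ih =>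
    cases h : idx t with
    | none =>
      rw [List.filter_cons_of_pos (by simp [h])]
      simp only [word, h, ih, Option.getD_none]
      rfl
    | some b =>
      rw [List.filter_cons_of_neg (by simp [h])]
      simp only [word, h, ih, Option.getD_some]
      rw [← Function.comp_assoc, word_comm hcomm, Function.comp_assoc]

theorem word_none (L : List ℕ) : word T (fun _ => none) L = id := by
  induction L with
  | nil => rfl
  | cons t L ih => simp [word, ih, letter]

theorem word_some (j : Fin k) (L : List ℕ) :
    word T (fun _ => some j) L = L.foldr (fun t f => T j t ∘ f) id := by
  induction L with
  | nil => rfl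
  | cons t L ih => simp [word, ih, letter]

theorem word_mp [MeasurableSpace X] {μ : Measure X} (hmp : ∀ j n, MeasurePreserving (T j n) μ μ)
    (w : ℕ → Option (Fin k)) (L : List ℕ) : MeasurePreserving (word T w L) μ μ := by
  induction L with
  | nil => exact MeasurePreserving.id μ
  | cons t L ih =>
    refine MeasurePreserving.comp ?_ ih
    cases w t with
    | none => exact MeasurePreserving.id μ
    | some j => exact hmp j t
end

/-- Extend a function on `Fin n`. -/
def extend {β : Type} {n : ℕ} (b : β) (w : Fin n → β) (t : ℕ) : β :=
  if h : t < n then w ⟨t, h⟩ else b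

theorem extend_line {β : Type} {n : ℕ} (b : β) (l : Line β (Fin n)) (a : β) :
    extend b (l a) = fun t => (extend (some b) l.idxFun t).getD a := by
  funext t
  by_cases h : t < n <;> simp [extend, h, Line.coe_apply]

theorem exists_pos_line {X : Type*} [MeasurableSpace X] (μ : Measure X)
    [IsProbabilityMeasure μ] {α ι : Type} [Fintype α] [Nonempty α] [Fintype ι] [DecidableEq ι]
    (A : Set X) (hA : MeasurableSet A)
    (hD : ∀ B : Set (ι → α), (μ.real A / 2) * K α ι ≤ ∑ x, ind (x ∈ B) →
      ∃ l : Line α ι, ∀ a, l a ∈ B) (hA0 : 0 < μ A)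
    (P : (ι → α) → X → X) (hP : ∀ w, MeasurePreserving (P w) μ μ) :
    ∃ l : Line α ι, 0 < μ {x | ∀ a, P (l a) x ∈ A} := by
  by_contra hcon
  push Not at hcon
  have hfin : Finite (Line α ι) :=
    Finite.of_injective (fun l : Line α ι => l.idxFun) (fun l l' h => by
      cases l; cases l'; simp only at h; subst h; rfl)
  have h1 : ∀ᵐ x ∂μ, ∀ l : Line α ι, ¬ ∀ a, P (l a) x ∈ A := by
    rw [ae_all_iff]
    intro l
    rw [ae_iff]
    simpa using hcon l
  have h2 : ∀ᵐ x ∂μ, ∑ w, (P w ⁻¹' A).indicator (1 : X → ℝ) x ≤ (μ.real A / 2) * K α ι := by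
    filter_upwards [h1] with x hx
    by_contra hlt
    push Not at hlt
    obtain ⟨l, hl⟩ := hD {w | P w x ∈ A} (by
      refine hlt.le.trans (le_of_eq (Finset.sum_congr rfl fun w _ => ?_))
      change _ = ind (P w x ∈ A)
      by_cases h : P w x ∈ A
      · rw [ind_pos h, Set.indicator_of_mem (show x ∈ P w ⁻¹' A from h)]; rfl
      · rw [ind_neg h, Set.indicator_of_notMem (show x ∉ P w ⁻¹' A from h)])
    exact hx l hl
  have hm : ∀ w, MeasurableSet (P w ⁻¹' A) := fun w => (hP w).measurable hA
  have hIntegr : ∀ w, Integrable ((P w ⁻¹' A).indicator (1 : X → ℝ)) μ := fun w =>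
    (integrable_const (1 : ℝ)).indicator (hm w)
  have h3 := integral_mono_ae (integrable_finsetSum Finset.univ (fun w _ => hIntegr w))
    (integrable_const _) h2
  rw [integral_finsetSum _ (fun w _ => hIntegr w)] at h3
  have h4 : ∀ w, ∫ x, (P w ⁻¹' A).indicator (1 : X → ℝ) x ∂μ = μ.real A := by
    intro w
    rw [integral_indicator_one (hm w)]
    exact congrArg ENNReal.toReal ((hP w).measure_preimage hA.nullMeasurableSet)
  simp only [h4, sum_words_const, integral_const, probReal_univ, one_smul] at h3
  have hpos : 0 < μ.real A := ENNReal.toReal_pos hA0.ne' (measure_ne_top μ A)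
  have := mul_pos hpos (K_pos α ι)
  linarith

end DHJ
end

/-- Furstenberg–Katznelson IP multiple recurrence: given `k` commuting IP-systems of
measure preserving transformations of a probability space and a set `A` of positive
measure, there is a nonempty finite index set `α` with
`μ(A ∩ (𝒯_α^{(1)})⁻¹(A) ∩ … ∩ (𝒯_α^{(k)})⁻¹(A)) > 0`. -/
theorem ip_multiple_recurrence {X : Type*} [MeasurableSpace X] (μ : Measure X)
    [IsProbabilityMeasure μ] (k : ℕ) (T : Fin k → ℕ → X → X)
    (hmp : ∀ j n, MeasurePreserving (T j n) μ μ)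
    (hcomm : ∀ i j m n, T i m ∘ T j n = T j n ∘ T i m)
    (A : Set X) (hA : MeasurableSet A) (hA0 : 0 < μ A) :
    ∃ α : Finset ℕ, α.Nonempty ∧
      0 < μ (A ∩ ⋂ j : Fin k, ipTrans (T j) α ⁻¹' A) := by
  have hpos : 0 < μ.real A := ENNReal.toReal_pos hA0.ne' (measure_ne_top μ A)
  obtain ⟨n, hn⟩ := DHJ.dhj_option k (μ.real A / 2) (by positivity)
  obtain ⟨l, hl⟩ := DHJ.exists_pos_line μ (α := Option (Fin k)) (ι := Fin n) A hA
    (hn (Fin n) (by simp)) hA0 (fun w => DHJ.word T (DHJ.extend none w) (List.range n))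
    (fun w => DHJ.word_mp hmp _ _)
  have hmp' := DHJ.word_mp (μ := μ) hmp
    (fun t => (DHJ.extend (some none) l.idxFun t).getD none) (List.range n)
  obtain ⟨L, hL⟩ : ∃ L, L = (List.range n).filter
    (fun t => (DHJ.extend (some none) l.idxFun t).isNone) := ⟨_, rfl⟩
  have hnd : L.Nodup := by rw [hL]; exact List.nodup_range.filter _
  have hsort : L.Pairwise (· ≤ ·) := by
    rw [hL]
    exact List.Pairwise.filter _ (List.pairwise_lt_range.imp (fun h => le_of_lt h))
  have hip : ∀ j, DHJ.word T (fun _ => some j) L = ipTrans (T j) L.toFinset := by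
    intro j
    rw [DHJ.word_some, ipTrans, (List.toFinset_sort (· ≤ ·) hnd).2 hsort]
  have hms : MeasurableSet (A ∩ ⋂ j : Fin k, ipTrans (T j) L.toFinset ⁻¹' A) := by
    refine hA.inter (MeasurableSet.iInter fun j => ?_)
    rw [← hip]
    exact (DHJ.word_mp hmp _ _).measurable hA
  refine ⟨L.toFinset, ?_, ?_⟩
  · obtain ⟨i, hi⟩ := l.proper
    refine ⟨i, ?_⟩
    rw [List.mem_toFinset, hL, List.mem_filter]
    simp [DHJ.extend, hi]
  · rw [← hmp'.measure_preimage hms.nullMeasurableSet]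
    refine lt_of_lt_of_le hl (measure_mono fun x hx => ?_)
    have hx' : ∀ a, DHJ.word T (fun _ => a) L
        (DHJ.word T (fun t => (DHJ.extend (some none) l.idxFun t).getD none)
          (List.range n) x) ∈ A := by
      intro a
      have h0 : DHJ.word T (DHJ.extend none (l a)) (List.range n) x ∈ A := hx a
      rw [DHJ.extend_line, DHJ.word_split hcomm, ← hL] at h0
      exact h0
    refine ⟨?_, Set.mem_iInter.2 fun j => ?_⟩
    · have := hx' none
      rwa [DHJ.word_none] at this
    · have := hx' (some j)
      rwa [hip] at this
end

section
/- (Multiple recurrence for rational systems) Let (X, ℬ, μ) be a measure space with μ(X) = 1, let k ∈ ℕ, and for each 1 ≤ j ≤ k let (T_{n,j})_{n∈ℤ\{0}} be measure-preserving transformations of X such that the whole family {T_{n,j} : n ∈ ℤ\{0}, 1 ≤ j ≤ k} is commuting. Then for every A ∈ ℬ with μ(A) > 0 there exist a nonempty finite set F = {t_1 < … < t_l} ⊆ ℤ\{0} and natural numbers (q_t)_{t∈F} with 1 ≤ q_t ≤ |t| for each t ∈ F, such that, setting 𝒯_j = T_{t_1,j}^{q_{t_1}}∘…∘T_{t_l,j}^{q_{t_l}}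 for each j, one has μ(A ∩ 𝒯_1^{-1}(A) ∩ … ∩ 𝒯_k^{-1}(A)) > 0. (Equivalently, the recurrence is achieved along the rational system at the nonzero rational q = Σ_{t∈F} q_t·c_t, where c_t = (-1)^{-t}/((-t+1)!) for t < 0 and c_t = (-1)^{t+1}·t! for t > 0.) -/
open MeasureTheory

/-- The coefficient `c_t` attached to a nonzero integer index `t`:
`c_t = (-1)^{-t}/((-t+1)!)` for `t < 0` and `c_t = (-1)^{t+1}·t!` for `t > 0`. -/
def ratCoeff (t : ℤ) : ℚ :=
  if t < 0 then (-1 : ℚ) ^ (-t).toNat / ((-t).toNat + 1).factorial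
  else (-1 : ℚ) ^ (t.toNat + 1) * (t.toNat).factorial

/-- The rational-system transformation `𝒯^q = T_{t_1}^{q_{t_1}} ∘ … ∘ T_{t_l}^{q_{t_l}}`
attached to a finite set `F = {t_1 < … < t_l}` of integer indices and exponents `q`. -/
def ratTrans {X : Type*} (T : ℤ → X → X) (q : ℤ → ℕ) (F : Finset ℤ) : X → X :=
  (F.sort (· ≤ ·)).foldr (fun t f => (T t)^[q t] ∘ f) id

namespace RMR
open Combinatorics

/-- Average of a real function on a finite type. -/
noncomputable def avg {X : Type} (f : X → ℝ) : ℝ := (∑ᶠ x, f x) / Nat.card X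

/-- Density of a set in a finite type. -/
noncomputable def dn {X : Type} (A : Set X) : ℝ := avg (A.indicator (fun _ => (1 : ℝ)))

set_option linter.unusedSectionVars false

section basics
variable {X Y : Type} [Finite X] [Finite Y]

lemma avg_fin [Fintype X] (f : X → ℝ) : avg f = (∑ x, f x) / Fintype.card X := by
  rw [avg, finsum_eq_sum_of_fintype, Nat.card_eq_fintype_card]

lemma avg_equiv (e : X ≃ Y) (f : Y → ℝ) : avg (fun x => f (e x)) = avg f := by
  have := Fintype.ofFinite X
  have := Fintype.ofFinite Y
  rw [avg_fin, avg_fin, Fintype.card_congr e, Equiv.sum_comp e f]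

lemma avg_prod (f : X × Y → ℝ) : avg f = avg fun x => avg fun y => f (x, y) := by
  have := Fintype.ofFinite X
  have := Fintype.ofFinite Y
  simp only [avg_fin]
  rw [Fintype.sum_prod_type, Fintype.card_prod, ← Finset.sum_div, div_div, Nat.cast_mul,
    mul_comm (Fintype.card X : ℝ)]

lemma avg_comm (f : X → Y → ℝ) :
    (avg fun x => avg fun y => f x y) = avg fun y => avg fun x => f x y := by
  rw [← avg_prod (fun p : X × Y => f p.1 p.2), ← avg_prod (fun p : Y × X => f p.2 p.1),
    ← avg_equiv (Equiv.prodComm Y X)]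
  rfl

lemma avg_mono {f g : X → ℝ} (h : ∀ x, f x ≤ g x) : avg f ≤ avg g := by
  have := Fintype.ofFinite X
  simp only [avg_fin]
  gcongr
  exact h _

lemma avg_add (f g : X → ℝ) : (avg fun x => f x + g x) = avg f + avg g := by
  have := Fintype.ofFinite X
  simp only [avg_fin, Finset.sum_add_distrib, add_div]

lemma avg_mul (c : ℝ) (f : X → ℝ) : (avg fun x => c * f x) = c * avg f := by
  have := Fintype.ofFinite X
  simp only [avg_fin, ← Finset.mul_sum, mul_div_assoc]

lemma avg_sub (f g : X → ℝ) : (avg fun x => f x - g x) = avg f - avg g := by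
  have := Fintype.ofFinite X
  simp only [avg_fin, Finset.sum_sub_distrib, sub_div]

lemma avg_sum {Q : Type} [Fintype Q] (f : Q → X → ℝ) :
    (avg fun x => ∑ q, f q x) = ∑ q, avg (f q) := by
  have := Fintype.ofFinite X
  simp only [avg_fin]
  rw [Finset.sum_comm, Finset.sum_div]

lemma avg_const [Nonempty X] (c : ℝ) : (avg fun _ : X => c) = c := by
  have := Fintype.ofFinite X
  simp [avg_fin]

lemma avg_le [Nonempty X] {f : X → ℝ} {c : ℝ} (h : ∀ x, f x ≤ c) : avg f ≤ c := by
  simpa [avg_const] using avg_mono h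

lemma le_avg [Nonempty X] {f : X → ℝ} {c : ℝ} (h : ∀ x, c ≤ f x) : c ≤ avg f := by
  simpa [avg_const] using avg_mono h

lemma dn_nonneg (A : Set X) : 0 ≤ dn A := by
  have := avg_mono (f := fun _ : X => 0) (g := A.indicator (fun _ => (1 : ℝ)))
    (fun x => Set.indicator_nonneg (fun _ _ => zero_le_one) x)
  refine le_trans ?_ this
  have := Fintype.ofFinite X
  simp [avg_fin]

lemma dn_le_one (A : Set X) : dn A ≤ 1 := by
  have := Fintype.ofFinite X
  rcases isEmpty_or_nonempty X with h | h
  · simp [dn, avg_fin]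
  · exact avg_le fun x => Set.indicator_le_self' (fun _ _ => zero_le_one) x

lemma dn_mono {A B : Set X} (h : A ⊆ B) : dn A ≤ dn B :=
  avg_mono fun x => Set.indicator_le_indicator_of_subset h (fun _ => zero_le_one) x

lemma nonempty_of_dn {A : Set X} (h : 0 < dn A) : A.Nonempty := by
  by_contra h'
  rw [Set.not_nonempty_iff_eq_empty] at h'
  subst h'
  have := Fintype.ofFinite X
  simp [dn, avg_fin] at h

lemma dn_prod (E : X → Y → Prop) :
    (avg fun x => dn {y | E x y}) = avg fun y => dn {x | E x y} := by
  simp only [dn]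
  rw [avg_comm]
  rfl

/-- Bounded averages: Markov. -/
lemma markov (f : X → ℝ) (hf : ∀ x, f x ≤ 1) {ε : ℝ} (hε : 0 < ε) (h : ε ≤ avg f) :
    ε / 2 ≤ dn {x | ε / 2 ≤ f x} := by
  rcases isEmpty_or_nonempty X with hX | hX
  · have := Fintype.ofFinite X
    simp [avg_fin] at h; linarith
  have : avg f ≤ avg fun x => ε / 2 + ({x | ε / 2 ≤ f x} : Set X).indicator (fun _ => (1 : ℝ)) x := by
    apply avg_mono
    intro x
    by_cases hx : ε / 2 ≤ f x
    · rw [Set.indicator_of_mem (by exact hx)]; linarith [hf x]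
    · rw [Set.indicator_of_notMem (by exact hx)]; linarith
  rw [avg_add, avg_const] at this
  simp only [dn]
  linarith

lemma pigeon {Q : Type} [Finite Q] (R : X → Q → Prop) (G : Set X)
    (h : ∀ x ∈ G, ∃ q, R x q) {c : ℝ} (hc : 0 < c) (hG : c ≤ dn G) :
    ∃ q, c / (Nat.card Q + 1) ≤ dn {x | R x q} := by
  have := Fintype.ofFinite Q
  by_contra! hcon
  have h1 : dn G ≤ ∑ q, dn {x | R x q} := by
    simp only [dn]
    rw [← avg_sum]
    apply avg_mono
    intro x
    by_cases hx : x ∈ G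
    · obtain ⟨q, hq⟩ := h x hx
      rw [Set.indicator_of_mem hx]
      refine le_trans ?_ (Finset.single_le_sum (f := fun q =>
        ({x | R x q} : Set X).indicator (fun _ => (1 : ℝ)) x) (fun q _ =>
        Set.indicator_nonneg (fun _ _ => zero_le_one) x) (Finset.mem_univ q))
      simp [hq]
    · rw [Set.indicator_of_notMem hx]
      exact Finset.sum_nonneg fun q _ => Set.indicator_nonneg (fun _ _ => zero_le_one) x
  have h2 : ∑ q, dn {x | R x q} ≤ ∑ q : Q, c / (Nat.card Q + 1) :=
    Finset.sum_le_sum fun q _ => (hcon q).le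
  simp only [Finset.sum_const, Finset.card_univ, nsmul_eq_mul, Nat.card_eq_fintype_card] at h2
  have h3 : (Fintype.card Q : ℝ) * (c / (Fintype.card Q + 1)) < c := by
    rw [mul_div_assoc', div_lt_iff₀ (by positivity)]
    nlinarith
  linarith

lemma find {Q : Type} [Finite Q] (E : X → Y → Prop) {ε : ℝ} (hε : 0 < ε)
    (pts : Q → Set X)
    (h : ∀ y, ε / 2 ≤ dn {x | E x y} → ∃ q, ∀ x ∈ pts q, E x y)
    (hE : ε ≤ avg fun y => dn {x | E x y}) :
    ∃ q, ε / 2 / (Nat.card Q + 1) ≤ dn {y | ∀ x ∈ pts q, E x y} :=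
  pigeon (fun y q => ∀ x ∈ pts q, E x y) {y | ε / 2 ≤ dn {x | E x y}} (fun y hy => h y hy)
    (by positivity) (markov _ (fun y => dn_le_one _) hε hE)

lemma avg_single (f : X → ℝ) (hf : ∀ x, 0 ≤ f x) (x0 : X) : f x0 / Nat.card X ≤ avg f := by
  have := Fintype.ofFinite X
  rw [avg_fin, Nat.card_eq_fintype_card]
  gcongr
  exact Finset.single_le_sum (fun q _ => hf q) (Finset.mem_univ x0)

lemma avg_sumType {ι κ β : Type} [Finite ι] [Finite κ] [Finite β] (f : (ι ⊕ κ → β) → ℝ) :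
    avg f = avg fun x : ι → β => avg fun y : κ → β => f (Sum.elim x y) := by
  rw [← avg_prod (fun p : (ι → β) × (κ → β) => f (Sum.elim p.1 p.2)),
    ← avg_equiv (Equiv.sumArrowEquivProdArrow ι κ β)]
  congr 1
  ext z
  congr 1
  ext i
  cases i <;> rfl

lemma dn_sumType {ι κ β : Type} [Finite ι] [Finite κ] [Finite β] (A : Set (ι ⊕ κ → β)) :
    dn A = avg fun x : ι → β => dn {y : κ → β | Sum.elim x y ∈ A} := by
  rw [dn, avg_sumType]
  rfl

instance {α ι : Type} [Finite α] [Finite ι] : Finite (Line α ι) :=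
  Finite.of_injective Line.idxFun fun a b h => by ext1; exact h

instance {α η ι : Type} [Finite α] [Finite ι] [Finite η] : Finite (Subspace η α ι) :=
  Finite.of_injective Subspace.idxFun fun a b h => by ext1; exact h

end basics
end RMR

namespace RMR
open Combinatorics
set_option linter.unusedSectionVars false

/-- Density Hales-Jewett for the alphabet `α`. -/
def DHJ (α : Type) : Prop := ∀ δ : ℝ, 0 < δ → ∃ (ι : Type) (_ : Finite ι),
  ∀ A : Set (ι → α), δ ≤ dn A → ∃ l : Line α ι, ∀ a, l a ∈ A

/-- Membership in `E` only depends on the word with `none` replaced by `a`. -/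
def Ins {α ι : Type} (a : α) (E : Set (ι → Option α)) : Prop :=
  ∀ z z' : ι → Option α, (∀ i, (z i).getD a = (z' i).getD a) → z ∈ E → z' ∈ E

section more
variable {X Y : Type} [Finite X] [Finite Y]

lemma dn_union_le (A B : Set X) : dn (A ∪ B) ≤ dn A + dn B := by
  simp only [dn]
  rw [← avg_add]
  apply avg_mono
  intro x
  by_cases h1 : x ∈ A <;> by_cases h2 : x ∈ B <;> simp [h1, h2]

lemma dn_singleton (x : X) : dn {x} = 1 / Nat.card X := by
  classical
  have := Fintype.ofFinite X
  simp [dn, avg_fin]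

lemma dn_sum_left {ι κ β : Type} [Finite ι] [Finite κ] [Finite β] [Nonempty β] (B : Set (ι → β)) :
    dn {z : ι ⊕ κ → β | (fun i => z (Sum.inl i)) ∈ B} = dn B := by
  rw [dn_sumType, dn]
  congr 1
  ext x
  by_cases h : x ∈ B
  · simp [h, dn, avg_const]
  · simp [h, dn, avg_const]

lemma dn_sum_right {ι κ β : Type} [Finite ι] [Finite κ] [Finite β] [Nonempty β] (B : Set (κ → β)) :
    dn {z : ι ⊕ κ → β | (fun i => z (Sum.inr i)) ∈ B} = dn B := by
  rw [dn_sumType]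
  exact avg_const (X := ι → β) (dn B)

lemma avg_range (φ : X → Y) (hφ : Function.Injective φ) [Nonempty X] (g : Y → ℝ) :
    avg ((Set.range φ).indicator g) = dn (Set.range φ) * avg (fun x => g (φ x)) := by
  classical
  have := Fintype.ofFinite X
  have := Fintype.ofFinite Y
  have key : ∀ g : Y → ℝ, ∑ y, (Set.range φ).indicator g y = ∑ x, g (φ x) := by
    intro g
    have h1 : ∑ x, g (φ x) = ∑ y ∈ Finset.univ.image φ, g y :=
      (Finset.sum_image (fun a _ b _ h => hφ h)).symm
    rw [h1, ← Finset.sum_subset (Finset.subset_univ (Finset.univ.image φ))]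
    · apply Finset.sum_congr rfl
      intro y hy
      rw [Set.indicator_of_mem]
      simpa using hy
    · intro y _ hy
      rw [Set.indicator_of_notMem]
      simpa using hy
  simp only [dn, avg_fin, key]
  have : (Fintype.card X : ℝ) ≠ 0 := by simp
  simp

end more

lemma subspace_injective {η β ι : Type} (W : Subspace η β ι) : Function.Injective W := by
  intro x y h
  ext e
  obtain ⟨i, hi⟩ := W.proper e
  have := congrFun h i
  simpa [Subspace.apply_inr hi] using this

/-- Tail estimate: most words over `Option α` have many letters different from `none`. -/
lemma tail {α : Type} [Finite α] [Nonempty α] (ι0 : Type) [Finite ι0] :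
    ∀ ε : ℝ, 0 < ε → ∃ (ι : Type) (_ : Finite ι),
      dn {z : ι → Option α | ¬ ∃ e : ι0 ↪ ι, ∀ j, (z (e j)).isSome = true} < ε := by
  induction ι0 using Finite.induction_empty_option with
  | of_equiv e ih =>
    intro ε hε
    obtain ⟨ι, h, hι⟩ := ih ε hε
    refine ⟨ι, h, lt_of_le_of_lt (dn_mono ?_) hι⟩
    rintro z hz ⟨f, hf⟩
    exact hz ⟨e.symm.toEmbedding.trans f, fun j => hf _⟩
  | h_empty =>
    intro ε hε
    refine ⟨Empty, inferInstance, ?_⟩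
    have : {z : Empty → Option α | ¬ ∃ e : PEmpty ↪ Empty, ∀ j, (z (e j)).isSome = true} = ∅ := by
      ext z
      simp only [Set.mem_ofPred_eq, Set.mem_empty_iff_false, iff_false, not_not]
      exact ⟨⟨fun x => x.elim, fun x => x.elim⟩, fun j => j.elim⟩
    rw [this]
    simp [dn, avg, hε]
  | h_option ih =>
    rename_i ι0 _
    intro ε hε
    obtain ⟨ι, h, hι⟩ := ih (ε / 2) (by positivity)
    have := Fintype.ofFinite α
    have hk : (1 : ℝ) / (Fintype.card α + 1) < 1 := by
      rw [div_lt_one (by positivity)]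
      have : 0 < Fintype.card α := Fintype.card_pos
      have : (0 : ℝ) < Fintype.card α := by exact_mod_cast this
      linarith
    obtain ⟨r, hr⟩ := exists_pow_lt_of_lt_one (show (0 : ℝ) < ε / 2 by positivity) hk
    refine ⟨ι ⊕ Fin r, inferInstance, ?_⟩
    have hsub : {z : ι ⊕ Fin r → Option α |
        ¬ ∃ e : Option ι0 ↪ ι ⊕ Fin r, ∀ j, (z (e j)).isSome = true} ⊆
        {z | (fun i => z (Sum.inl i)) ∈
          {z : ι → Option α | ¬ ∃ e : ι0 ↪ ι, ∀ j, (z (e j)).isSome = true}} ∪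
        {z | (fun i => z (Sum.inr i)) ∈ ({fun _ => none} : Set (Fin r → Option α))} := by
      intro z hz
      by_contra hcon
      simp only [Set.mem_union, Set.mem_ofPred_eq, not_or, not_not, Set.mem_singleton_iff] at hcon
      obtain ⟨⟨e, he⟩, h2⟩ := hcon
      have : ∃ j : Fin r, z (Sum.inr j) ≠ none := by
        by_contra! h3
        exact h2 (funext h3)
      obtain ⟨j, hj⟩ := this
      refine hz ⟨⟨fun o => o.elim (Sum.inr j) (fun i => Sum.inl (e i)), ?_⟩, ?_⟩
      · rintro (_ | a) (_ | b) hab <;> simp_all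
      · rintro (_ | a)
        · exact Option.isSome_iff_ne_none.2 hj
        · exact he a
    refine lt_of_le_of_lt ((dn_mono hsub).trans (dn_union_le _ _)) ?_
    rw [dn_sum_left, dn_sum_right, dn_singleton]
    have : (1 : ℝ) / Nat.card (Fin r → Option α) = (1 / (Fintype.card α + 1)) ^ r := by
      rw [Nat.card_fun]
      simp
    rw [this]
    linarith

lemma line_ins {α ι : Type} {a : α} {E : Set (ι → Option α)} (hE : Ins a E) (l : Line (Option α) ι)
    (h : l (some a) ∈ E) : l none ∈ E := by
  refine hE _ _ (fun i => ?_) h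
  simp only [Line.coe_apply]
  cases l.idxFun i <;> simp

/-- Dense insensitive sets contain lines. -/
lemma S1 {α : Type} [Finite α] [Nonempty α] (hD : DHJ α) (a : α) (ε : ℝ) (hε : 0 < ε) :
    ∃ (ι : Type) (_ : Finite ι), ∀ E : Set (ι → Option α), Ins a E → ε ≤ dn E →
      ∃ l : Line (Option α) ι, ∀ b, l b ∈ E := by
  classical
  obtain ⟨ι0, hι0, h0⟩ := hD (ε / 2) (by positivity)
  obtain ⟨ι, hι, htail⟩ := tail (α := α) ι0 (ε / 2) (by positivity)
  refine ⟨ι, hι, fun E hE hdE => ?_⟩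
  let P : (ι → Bool) → Prop := fun b => ∃ e : ι0 ↪ ι, ∀ j, b (e j) = true
  let pat : (ι → Option α) → (ι → Bool) := fun z i => (z i).isSome
  let e : ∀ b, P b → ι0 ↪ ι := fun b h => h.choose
  have he : ∀ b (h : P b) j, b (e b h j) = true := fun b h => h.choose_spec
  let ov : (b : ι → Bool) → P b → (ι0 → α) → (ι → Option α) → (ι → Option α) :=
    fun b h x z => Function.extend (e b h) (fun j => some (x j)) z
  have hpat : ∀ z (h : P (pat z)) x, pat (ov _ h x z) = pat z := by
    intro z h x
    ext i
    by_cases hi : ∃ j, e _ h j = i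
    · obtain ⟨j, rfl⟩ := hi
      have := he _ h j
      simp only [pat, ov, (e _ h).injective.extend_apply] at this ⊢
      simp [this]
    · simp only [pat, ov, Function.extend_apply' _ _ _ hi]
  let inv : (ι → Option α) × (ι0 → α) → (ι → Option α) × (ι0 → α) := fun p =>
    if h : P (pat p.1) then (ov _ h p.2 p.1, fun j => (p.1 (e _ h j)).getD a) else p
  have hinv : Function.Involutive inv := by
    rintro ⟨z, x⟩
    by_cases h : P (pat z)
    · have h1 : inv (z, x) = (ov _ h x z, fun j => (z (e _ h j)).getD a) := by simp only [inv, h, dif_pos]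
      have h' : P (pat (ov _ h x z)) := by rw [hpat]; exact h
      have h2 : e _ h' = e _ h := by
        have : ∀ b (hb : P b), b = pat z → e b hb = e _ h := by rintro b hb rfl; rfl
        exact this _ _ (hpat z h x)
      rw [h1]
      simp only [inv, h', dif_pos]
      ext i
      · simp only [ov, h2]
        by_cases hi : ∃ j, e _ h j = i
        · obtain ⟨j, rfl⟩ := hi
          rw [(e _ h).injective.extend_apply]
          have := he _ h j
          obtain ⟨c, hc⟩ := Option.isSome_iff_exists.1 (show (z (e _ h j)).isSome = true from this)
          simp [hc]
        · rw [Function.extend_apply' _ _ _ hi, Function.extend_apply' _ _ _ hi]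
      · simp only [ov, h2, (e _ h).injective.extend_apply]
        rfl
    · have h1 : inv (z, x) = (z, x) := by simp only [inv, h, dif_neg, not_false_iff]
      rw [h1, h1]
  let G : Set (ι → Option α) := {z | P (pat z)}
  have hG : ε / 2 < dn (E ∩ G) := by
    have h1 : dn E ≤ dn (E ∩ G) + dn Gᶜ := by
      refine le_trans (dn_mono ?_) (dn_union_le _ _)
      intro z hz
      by_cases h : z ∈ G
      · exact Or.inl ⟨hz, h⟩
      · exact Or.inr h
    have h2 : dn Gᶜ < ε / 2 := htail
    linarith
  have h3 : dn (E ∩ G) = avg fun z => dn {x : ι0 → α | (inv (z, x)).1 ∈ E ∩ G} := by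
    have h4 : dn (E ∩ G) = avg fun p : (ι → Option α) × (ι0 → α) =>
        (E ∩ G).indicator (fun _ => (1 : ℝ)) p.1 := by
      rw [avg_prod]
      simp only [avg_const]
      rfl
    rw [h4, ← avg_equiv hinv.toPerm, avg_prod]
    rfl
  rw [h3] at hG
  have h5 : ∃ z, ε / 2 < dn {x : ι0 → α | (inv (z, x)).1 ∈ E ∩ G} := by
    by_contra! hcon
    exact absurd (avg_le hcon) (not_le.2 hG)
  obtain ⟨z, hz⟩ := h5
  obtain ⟨l, hl⟩ := h0 _ hz.le
  have hzG : P (pat z) := by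
    by_contra h
    have := hl a
    simp only [Set.mem_ofPred_eq, inv, h, dif_neg, not_false_iff] at this
    exact h this.2
  simp only [Set.mem_ofPred_eq, inv, hzG, dif_pos] at hl
  let L : Line (Option α) ι :=
    { idxFun := Function.extend (e _ hzG) (fun j => (l.idxFun j).map some) (fun i => some (z i))
      proper := by
        obtain ⟨j, hj⟩ := l.proper
        refine ⟨e _ hzG j, ?_⟩
        rw [(e _ hzG).injective.extend_apply, hj]
        rfl }
  have hL : ∀ c : α, L (some c) = ov _ hzG (l c) z := by
    intro c
    ext1 i
    simp only [Line.coe_apply, L, ov]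
    by_cases hi : ∃ j, e _ hzG j = i
    · obtain ⟨j, rfl⟩ := hi
      rw [(e _ hzG).injective.extend_apply, (e _ hzG).injective.extend_apply]
      cases l.idxFun j <;> rfl
    · rw [Function.extend_apply' _ _ _ hi, Function.extend_apply' _ _ _ hi]
      rfl
  refine ⟨L, ?_⟩
  have : ∀ c : α, L (some c) ∈ E := fun c => by rw [hL]; exact (hl c).1
  rintro (_ | c)
  · exact line_ins hE L (this a)
  · exact this c

/-- A line times a subspace. -/
def lineProd {η β ι κ : Type} (l : Line β ι) (W : Subspace η β κ) :
    Subspace (Option η) β (ι ⊕ κ) where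
  idxFun := Sum.elim (fun i => (l.idxFun i).elim (Sum.inr none) Sum.inl)
    (fun j => (W.idxFun j).map id some)
  proper := by
    rintro (_ | e)
    · obtain ⟨i, hi⟩ := l.proper
      exact ⟨Sum.inl i, by simp [hi]⟩
    · obtain ⟨i, hi⟩ := W.proper e
      exact ⟨Sum.inr i, by simp [hi]⟩

lemma lineProd_apply {η β ι κ : Type} (l : Line β ι) (W : Subspace η β κ) (x : Option η → β) :
    lineProd l W x = Sum.elim (l (x none)) (W (fun e => x (some e))) := by
  ext1 i
  rcases i with i | j
  · simp only [Subspace.coe_apply, lineProd, Sum.elim_inl, Line.coe_apply]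
    cases l.idxFun i <;> rfl
  · simp only [Subspace.coe_apply, lineProd, Sum.elim_inr]
    cases W.idxFun j <;> rfl

/-- Slice: a fixed word times a subspace. -/
def constProd {η β ι κ : Type} (u : ι → β) (W : Subspace η β κ) :
    Subspace η β (ι ⊕ κ) where
  idxFun := Sum.elim (fun i => Sum.inl (u i)) W.idxFun
  proper := fun e => by
    obtain ⟨i, hi⟩ := W.proper e
    exact ⟨Sum.inr i, by simp [hi]⟩

lemma constProd_apply {η β ι κ : Type} (u : ι → β) (W : Subspace η β κ) (x : η → β) :
    constProd u W x = Sum.elim u (W x) := by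
  ext1 i
  rcases i with i | j <;> rfl

/-- Composition of subspaces. -/
def comp {η η' β ι : Type} (W : Subspace η' β ι) (U : Subspace η β η') : Subspace η β ι where
  idxFun i := (W.idxFun i).elim Sum.inl U.idxFun
  proper e := by
    obtain ⟨j, hj⟩ := U.proper e
    obtain ⟨i, hi⟩ := W.proper j
    exact ⟨i, by simp [hi, hj]⟩

lemma comp_apply {η η' β ι : Type} (W : Subspace η' β ι) (U : Subspace η β η') (x : η → β) :
    comp W U x = W (U x) := by
  ext1 i
  simp only [Subspace.coe_apply, comp]
  cases W.idxFun i <;> simp [Subspace.coe_apply]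

lemma Ins.slice {α ι κ : Type} {a : α} {E : Set (ι ⊕ κ → Option α)} (hE : Ins a E)
    (x : ι → Option α) : Ins a {y : κ → Option α | Sum.elim x y ∈ E} := by
  intro z z' h hz
  refine hE _ _ ?_ hz
  rintro (i | i)
  · rfl
  · exact h i

lemma Ins.slice' {α ι κ : Type} {a : α} {E : Set (ι ⊕ κ → Option α)} (hE : Ins a E)
    (y : κ → Option α) : Ins a {x : ι → Option α | Sum.elim x y ∈ E} := by
  intro z z' h hz
  refine hE _ _ ?_ hz
  rintro (i | i)
  · exact h i
  · rfl

lemma Ins.pull {α ι η : Type} {a : α} {E : Set (ι → Option α)} (hE : Ins a E)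
    (W : Subspace η (Option α) ι) : Ins a {x | W x ∈ E} := by
  intro z z' h hz
  refine hE _ _ ?_ hz
  intro i
  simp only [Subspace.coe_apply]
  cases W.idxFun i with
  | inl b => rfl
  | inr e => exact h e

lemma Ins.forall {α ι Q : Type} {a : α} {E : Q → Set (ι → Option α)} (hE : ∀ q, Ins a (E q)) :
    Ins a {x | ∀ q, x ∈ E q} :=
  fun z y hzy hz q => hE q z y hzy (hz q)

/-- Dense insensitive sets contain subspaces. -/
lemma Sd {α : Type} [Finite α] [Nonempty α] (hD : DHJ α) (a : α) (η : Type) [Finite η] :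
    ∀ ε : ℝ, 0 < ε →
    ∃ (ι : Type) (_ : Finite ι), ∀ E : Set (ι → Option α), Ins a E → ε ≤ dn E →
      ∃ W : Subspace η (Option α) ι, ∀ x, W x ∈ E := by
  induction η using Finite.induction_empty_option with
  | of_equiv e ih =>
    intro ε hε
    obtain ⟨ι, h, hι⟩ := ih ε hε
    refine ⟨ι, h, fun E hE hd => ?_⟩
    obtain ⟨W, hW⟩ := hι E hE hd
    refine ⟨W.reindex e (Equiv.refl _) (Equiv.refl _), fun x => ?_⟩
    have := hW (x ∘ e)
    convert this using 1
    ext1 i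
    rw [Subspace.reindex_apply]
    rfl
  | h_empty =>
    intro ε hε
    refine ⟨Empty, inferInstance, fun E hE hd => ?_⟩
    obtain ⟨z, hz⟩ := nonempty_of_dn (lt_of_lt_of_le hε hd)
    refine ⟨⟨fun i => i.elim, fun e => e.elim⟩, fun x => ?_⟩
    convert hz
  | h_option ih =>
    rename_i η _
    intro ε hε
    obtain ⟨ι, h, hι⟩ := S1 hD a (ε / 2) (by positivity)
    obtain ⟨κ, hκ', hκ⟩ := ih (ε / 2 / (Nat.card (Line (Option α) ι) + 1)) (by positivity)
    refine ⟨ι ⊕ κ, inferInstance, fun E hE hd => ?_⟩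
    obtain ⟨l, hl⟩ := find (X := ι → Option α) (Y := κ → Option α)
      (fun x y => Sum.elim x y ∈ E) hε (fun l : Line (Option α) ι => Set.range l)
      (fun y hy => by
        obtain ⟨l, hl⟩ := hι _ (hE.slice' y) hy
        refine ⟨l, ?_⟩
        rintro _ ⟨b, rfl⟩
        exact hl b) (by
        rw [← dn_prod, ← dn_sumType]
        exact hd)
    have hI : Ins a {y : κ → Option α | ∀ x ∈ Set.range l, Sum.elim x y ∈ E} := by
      intro z z' h hz x hx
      exact hE.slice x z z' h (hz x hx)
    obtain ⟨W, hW⟩ := hκ _ hI hl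
    refine ⟨lineProd l W, fun x => ?_⟩
    rw [lineProd_apply]
    exact hW _ _ ⟨_, rfl⟩

end RMR

namespace RMR
open Combinatorics
set_option linter.unusedSectionVars false

lemma avg_ind_le {X : Type} [Finite X] (E : Set X) (f : X → ℝ) (hf : ∀ x, |f x| ≤ 1) :
    avg (E.indicator f) ≤ dn E := by
  apply avg_mono
  intro x
  by_cases h : x ∈ E
  · simp only [h, Set.indicator_of_mem]
    exact (abs_le.1 (hf x)).2
  · simp [h]

/-- One insensitive set, `r` rounds of exhaustion. -/
lemma rounds {α : Type} [Finite α] [Nonempty α] (a : α) (η M : Type) [Finite η] [Finite M]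
    (ε : ℝ) (hε : 0 < ε)
    (hM : ∀ E : Set (M → Option α), Ins a E → ε / 2 ≤ dn E →
      ∃ W : Subspace η (Option α) M, ∀ x, W x ∈ E)
    (θ : ℝ) (hθ : θ = ε / 2 / (Nat.card (Subspace η (Option α) M) + 1) / Nat.card (M → Option α))
    (hθ1 : θ ≤ 1) (r : ℕ) :
    ∃ (ι : Type) (_ : Finite ι), ∀ E : Set (ι → Option α), Ins a E → ∀ f : (ι → Option α) → ℝ,
      (∀ z, |f z| ≤ 1) → ∀ τ : ℝ, 0 ≤ τ →
      (∀ W : Subspace η (Option α) ι, avg (fun x => f (W x)) ≤ τ) →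
      avg (E.indicator f) ≤ τ * dn E + ε + (1 - θ) ^ r * dn E := by
  induction r with
  | zero =>
    refine ⟨Empty, inferInstance, fun E hE f hf τ hτ h => ?_⟩
    have := avg_ind_le E f hf
    have := mul_nonneg hτ (dn_nonneg E)
    simp only [pow_zero, one_mul]
    linarith
  | succ r ih =>
    obtain ⟨κ, hκ', hκ⟩ := ih
    refine ⟨M ⊕ κ, inferInstance, fun E hE f hf τ hτ h => ?_⟩
    have hp : 0 ≤ (1 - θ) ^ r := pow_nonneg (by linarith) r
    have hp' : 0 ≤ (1 - θ) ^ (r + 1) := pow_nonneg (by linarith) _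
    have hd0 := dn_nonneg E
    have hd1 := dn_le_one E
    by_cases hdE : dn E < ε
    · have := avg_ind_le E f hf
      have := mul_nonneg hτ hd0
      have := mul_nonneg hp' hd0
      linarith
    push Not at hdE
    obtain ⟨W, hW⟩ := find (X := M → Option α) (Y := κ → Option α)
      (fun x y => Sum.elim x y ∈ E) hε (fun W : Subspace η (Option α) M => Set.range W)
      (fun y hy => by
        obtain ⟨W, hW⟩ := hM _ (hE.slice' y) hy
        refine ⟨W, ?_⟩
        rintro _ ⟨b, rfl⟩
        exact hW b) (by
        rw [← dn_prod, ← dn_sumType]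
        exact hdE)
    set Y : Set (κ → Option α) := {y | ∀ x ∈ Set.range W, Sum.elim x y ∈ E} with hY
    set R : Set (M → Option α) := Set.range W with hR
    have hYI : Ins a Y := by
      intro z z' h hz x hx
      exact hE.slice x z z' h (hz x hx)
    let E' : (M → Option α) → Set (κ → Option α) := fun x =>
      {y | Sum.elim x y ∈ E ∧ ¬ (x ∈ R ∧ y ∈ Y)}
    have hE' : ∀ x, Ins a (E' x) := by
      rintro x z z' hzz ⟨h1, h2⟩
      refine ⟨hE.slice x z z' hzz h1, fun h3 => h2 ⟨h3.1, hYI z' z (fun i => (hzz i).symm) h3.2⟩⟩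
    have hsplit : ∀ (g : (M ⊕ κ → Option α) → ℝ) x y, E.indicator g (Sum.elim x y) =
        (E' x).indicator (fun y => g (Sum.elim x y)) y +
          R.indicator (fun x => Y.indicator (fun y => g (Sum.elim x y)) y) x := by
      intro g x y
      by_cases hx : x ∈ R <;> by_cases hy : y ∈ Y
      · have h1 : Sum.elim x y ∈ E := hy x hx
        have h2 : y ∉ E' x := fun h => h.2 ⟨hx, hy⟩
        simp [h1, h2, hx, hy]
      all_goals
        have h2 : y ∈ E' x ↔ Sum.elim x y ∈ E :=
          ⟨fun h => h.1, fun h => ⟨h, fun h' => by first | exact hx h'.1 | exact hy h'.2⟩⟩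
        by_cases h1 : Sum.elim x y ∈ E
        · simp [h1, h2, hx, hy]
        · simp [h1, h2, hx, hy]
    have hsum : ∀ g : (M ⊕ κ → Option α) → ℝ, avg (E.indicator g) =
        (avg fun x => avg ((E' x).indicator (fun y => g (Sum.elim x y)))) +
        avg fun y => Y.indicator (fun y => dn R * avg (fun u => g (Sum.elim (W u) y))) y := by
      intro g
      rw [avg_sumType]
      simp only [hsplit, avg_add]
      congr 1
      rw [avg_comm]
      congr 1
      ext y
      by_cases hy : y ∈ Y
      · simp only [hy, Set.indicator_of_mem]
        rw [← avg_range W (subspace_injective W) (fun x => g (Sum.elim x y))]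
      · simp [hy, avg_const]
    have hmass : dn E = (avg fun x => dn (E' x)) + dn R * dn Y := by
      have := hsum (fun _ => 1)
      simp only [avg_const] at this
      rw [show dn E = avg (E.indicator fun _ => (1 : ℝ)) from rfl, this]
      congr 1
      rw [show dn Y = avg (Y.indicator fun _ => (1 : ℝ)) from rfl, ← avg_mul]
      congr 1
      ext y
      by_cases hy : y ∈ Y <;> simp [hy]
    have hRpos : 1 / (Nat.card (M → Option α) : ℝ) ≤ dn R := by
      rw [← dn_singleton (W fun _ => none)]
      apply dn_mono
      rintro _ rfl
      exact ⟨_, rfl⟩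
    have hm : θ ≤ dn R * dn Y := by
      rw [hθ, div_eq_mul_one_div, mul_comm]
      exact mul_le_mul hRpos hW (by positivity) (dn_nonneg _)
    have h1 : (avg fun y => Y.indicator (fun y => dn R * avg (fun u => f (Sum.elim (W u) y))) y) ≤
        τ * (dn R * dn Y) := by
      have h2 : τ * (dn R * dn Y) = avg fun y => (τ * dn R) * Y.indicator (fun _ => (1 : ℝ)) y := by
        rw [avg_mul, ← mul_assoc]
        rfl
      rw [h2]
      apply avg_mono
      intro y
      by_cases hy : y ∈ Y
      · simp only [hy, Set.indicator_of_mem, mul_one]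
        rw [mul_comm τ]
        refine mul_le_mul_of_nonneg_left ?_ (dn_nonneg _)
        let W' : Subspace η (Option α) (M ⊕ κ) :=
          { idxFun := Sum.elim W.idxFun (fun j => Sum.inl (y j))
            proper := fun e => by
              obtain ⟨i, hi⟩ := W.proper e
              exact ⟨Sum.inl i, by simp [hi]⟩ }
        have hW' : ∀ u, W' u = Sum.elim (W u) y := by
          intro u
          ext1 i
          rcases i with i | j <;> rfl
        have := h W'
        simpa only [hW'] using this
      · simp [hy]
    have h2 : (avg fun x => avg ((E' x).indicator (fun y => f (Sum.elim x y)))) ≤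
        avg fun x => ((τ + (1 - θ) ^ r) * dn (E' x) + ε) := by
      apply avg_mono
      intro x
      have := hκ (E' x) (hE' x) (fun y => f (Sum.elim x y)) (fun y => hf _) τ hτ (fun U => by
        have := h (constProd x U)
        simpa only [constProd_apply] using this)
      linarith
    rw [avg_add, avg_mul, avg_const] at h2
    rw [hsum f]
    set S := avg fun x => dn (E' x)
    have h3 : S ≤ (1 - θ) * dn E := by
      have h0 : 0 ≤ θ := by rw [hθ]; positivity
      nlinarith
    have h4 := mul_le_mul_of_nonneg_left h3 hp
    rw [← mul_assoc, ← pow_succ] at h4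
    have h5 : τ * dn E = τ * S + τ * (dn R * dn Y) := by rw [hmass]; ring
    linarith

lemma T1 {α : Type} [Finite α] [Nonempty α] (hD : DHJ α) (a : α) (η : Type) [Finite η]
    (ε : ℝ) (hε : 0 < ε) :
    ∃ (ι : Type) (_ : Finite ι), ∀ E : Set (ι → Option α), Ins a E → ∀ f : (ι → Option α) → ℝ,
      (∀ z, |f z| ≤ 1) → ∀ τ : ℝ, 0 ≤ τ →
      (∀ W : Subspace η (Option α) ι, avg (fun x => f (W x)) ≤ τ) →
      avg (E.indicator f) ≤ τ + ε := by
  wlog hε1 : ε ≤ 1 generalizing ε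
  · obtain ⟨ι, h, hι⟩ := this 1 one_pos le_rfl
    refine ⟨ι, h, fun E hE f hf τ hτ hW => ?_⟩
    have := hι E hE f hf τ hτ hW
    linarith
  obtain ⟨M, hMf, hM⟩ := Sd hD a η (ε / 2 / 2) (by positivity)
  set θ : ℝ := ε / 2 / 2 / (Nat.card (Subspace η (Option α) M) + 1) / Nat.card (M → Option α) with hθ
  have hc : (1 : ℝ) ≤ Nat.card (M → Option α) := by
    exact_mod_cast Nat.succ_le_of_lt Nat.card_pos
  have hθ0 : 0 < θ := by positivity
  have hθ1 : θ ≤ 1 := by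
    rw [hθ]
    apply div_le_one_of_le₀ _ (by positivity)
    refine le_trans ?_ hc
    apply div_le_one_of_le₀ _ (by positivity)
    have : (0 : ℝ) ≤ Nat.card (Subspace η (Option α) M) := by positivity
    linarith
  obtain ⟨r, hr⟩ := exists_pow_lt_of_lt_one (show 0 < ε / 2 by positivity) (show 1 - θ < 1 by linarith)
  obtain ⟨ι, h, hι⟩ := rounds a η M (ε / 2) (by positivity) hM θ hθ hθ1 r
  refine ⟨ι, h, fun E hE f hf τ hτ hW => ?_⟩
  have h1 := hι E hE f hf τ hτ hW
  have h2 : τ * dn E ≤ τ := mul_le_of_le_one_right hτ (dn_le_one E)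
  have h3 : (1 - θ) ^ r * dn E ≤ (1 - θ) ^ r :=
    mul_le_of_le_one_right (pow_nonneg (by linarith) r) (dn_le_one E)
  linarith

lemma Tm {α : Type} [Finite α] [Nonempty α] (hD : DHJ α) (J : Finset α) :
    ∀ (η : Type) [Finite η] (ε : ℝ), 0 < ε →
    ∃ (ι : Type) (_ : Finite ι), ∀ E : α → Set (ι → Option α), (∀ a ∈ J, Ins a (E a)) →
      ∀ f : (ι → Option α) → ℝ, (∀ z, |f z| ≤ 1) → ∀ τ : ℝ, 0 ≤ τ →
      (∀ W : Subspace η (Option α) ι, avg (fun x => f (W x)) ≤ τ) →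
      avg (Set.indicator {z | ∀ a ∈ J, z ∈ E a} f) ≤ τ + ε := by
  classical
  induction J using Finset.induction_on with
  | empty =>
    intro η _ ε hε
    refine ⟨η, inferInstance, fun E hE f hf τ hτ hW => ?_⟩
    have := hW ⟨Sum.inr, fun e => ⟨e, rfl⟩⟩
    have h2 : Set.indicator {z : η → Option α | ∀ a ∈ (∅ : Finset α), z ∈ E a} f = f := by
      ext z; simp
    rw [h2]
    exact le_trans this (by linarith)
  | insert a J ha ih =>
    intro η _ ε hε
    obtain ⟨ι', h', hι'⟩ := T1 hD a η (ε / 2) (by positivity)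
    obtain ⟨ι, h, hι⟩ := ih ι' (ε / 2) (by positivity)
    refine ⟨ι, h, fun E hE f hf τ hτ hW => ?_⟩
    have := hι E (fun b hb => hE b (Finset.mem_insert_of_mem hb)) ((E a).indicator f)
      (fun z => by
        by_cases hz : z ∈ E a
        · simpa [hz] using hf z
        · simp [hz]) (τ + ε / 2) (by positivity) (fun W => by
        have h1 := hι' {x | W x ∈ E a} ((hE a (Finset.mem_insert_self _ _)).pull W)
          (fun x => f (W x)) (fun x => hf _) τ hτ (fun U => by
            simpa only [comp_apply] using hW (comp W U))
        exact h1)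
    rw [add_assoc, add_halves] at this
    convert this using 2
    ext z
    by_cases h1 : z ∈ E a <;> by_cases h2 : ∀ b ∈ J, z ∈ E b <;>
      simp [Set.indicator_apply, h1, h2]

end RMR

namespace RMR
open Combinatorics
set_option linter.unusedSectionVars false

/-- View a subspace over `α` as one over `Option α`. -/
def lift {α η ι : Type} (V : Subspace η α ι) : Subspace η (Option α) ι where
  idxFun i := (V.idxFun i).map some id
  proper e := by
    obtain ⟨i, hi⟩ := V.proper e
    exact ⟨i, by simp [hi]⟩

lemma lift_getD {α η ι : Type} (V : Subspace η α ι) (z : η → Option α) (a : α) (i : ι) :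
    (lift V z i).getD a = V (fun e => (z e).getD a) i := by
  simp only [Subspace.coe_apply, lift]
  cases V.idxFun i <;> simp

lemma lift_some {α η ι : Type} (V : Subspace η α ι) (z : η → α) (i : ι) :
    lift V (fun e => some (z e)) i = some (V z i) := by
  simp only [Subspace.coe_apply, lift]
  cases V.idxFun i <;> simp

lemma ramsey {α : Type} [Finite α] (p : Type) [Finite p] :
    ∀ (Γ : Type) [Finite Γ] (η : Type) [Finite η], ∃ (M : Type) (_ : Finite M),
      ∀ c : (M → Option α) → Γ, ∃ V : Subspace (p ⊕ η) α M, ∀ w : p → Option α,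
        (∃ i, w i = none) → ∀ s s' : η → Option α,
          c (lift V (Sum.elim w s)) = c (lift V (Sum.elim w s')) := by
  induction p using Finite.induction_empty_option with
  | of_equiv e ih =>
    intro Γ _ η _
    obtain ⟨M, h, hM⟩ := ih Γ η
    refine ⟨M, h, fun c => ?_⟩
    obtain ⟨V, hV⟩ := hM c
    let V' := V.reindex (Equiv.sumCongr e (Equiv.refl η)) (Equiv.refl α) (Equiv.refl M)
    have hV' : ∀ w s, lift V' (Sum.elim w s) = lift V (Sum.elim (fun i => w (e i)) s) := by
      intro w s
      ext1 i
      simp only [Subspace.coe_apply, lift, V', Subspace.reindex, Equiv.refl_symm, Equiv.refl_apply]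
      rcases V.idxFun i with b | (b | b) <;> simp
    refine ⟨V', fun w hw s s' => ?_⟩
    rw [hV', hV']
    obtain ⟨i, hi⟩ := hw
    exact hV _ ⟨e.symm i, by simpa using hi⟩ s s'
  | h_empty =>
    intro Γ _ η _
    refine ⟨η, inferInstance, fun c => ⟨⟨fun i => Sum.inr (Sum.inr i), ?_⟩, ?_⟩⟩
    · rintro (e | e)
      · exact e.elim
      · exact ⟨e, rfl⟩
    · rintro w ⟨i, _⟩
      exact i.elim
  | h_option ih =>
    rename_i p _
    intro Γ _ η _
    obtain ⟨M', h', hM'⟩ := ih (α → Γ) η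
    obtain ⟨M2, h2, hM2⟩ := Subspace.exists_mono_in_high_dimension (Option α) Γ M'
    refine ⟨Option M2, inferInstance, fun c => ?_⟩
    obtain ⟨S, c0, hS⟩ := hM2 (fun s => c (fun o => o.elim none s))
    let V1 : Subspace (Option M') α (Option M2) :=
      { idxFun := fun o => o.elim (Sum.inr none)
          (fun j => (S.idxFun j).elim (fun x => x.elim (Sum.inr none) Sum.inl)
            (fun e => Sum.inr (some e)))
        proper := by
          rintro (_ | e)
          · exact ⟨none, rfl⟩
          · obtain ⟨i, hi⟩ := S.proper e
            exact ⟨some i, by simp [hi]⟩ }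
    have hV1 : ∀ t : M' → Option α, lift V1 (fun o => o.elim none t) = fun o => o.elim none (S t) := by
      intro t
      ext1 i
      simp only [Subspace.coe_apply, lift, V1]
      rcases i with _ | i
      · rfl
      · simp only [Option.elim_some, Subspace.coe_apply]
        rcases S.idxFun i with (_ | b) | e <;> simp
    obtain ⟨V', hV'⟩ := hM' (fun t b => c (lift V1 (fun o => o.elim (some b) t)))
    let V : Subspace (Option p ⊕ η) α (Option M2) :=
      { idxFun := fun i => (V1.idxFun i).elim Sum.inl (fun o => o.elim (Sum.inr (Sum.inl none))
          (fun e => (V'.idxFun e).map id (Sum.map some id)))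
        proper := by
          rintro ((_ | e) | e)
          · obtain ⟨i, hi⟩ := V1.proper none
            exact ⟨i, by simp [hi]⟩
          · obtain ⟨j, hj⟩ := V'.proper (Sum.inl e)
            obtain ⟨i, hi⟩ := V1.proper (some j)
            exact ⟨i, by simp [hi, hj]⟩
          · obtain ⟨j, hj⟩ := V'.proper (Sum.inr e)
            obtain ⟨i, hi⟩ := V1.proper (some j)
            exact ⟨i, by simp [hi, hj]⟩ }
    have hV : ∀ (w : Option p → Option α) s, lift V (Sum.elim w s) =
        lift V1 (fun o => o.elim (w none) (lift V' (Sum.elim (fun i => w (some i)) s))) := by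
      intro w s
      ext1 i
      simp only [Subspace.coe_apply, lift, V]
      rcases V1.idxFun i with b | (_ | e)
      · simp
      · simp
      · simp only [Sum.elim_inr, Option.elim_some, Sum.map_inr, id, Subspace.coe_apply]
        rcases V'.idxFun e with b | (b | b) <;> simp
    refine ⟨V, fun w hw s s' => ?_⟩
    rw [hV, hV]
    rcases hwn : w none with _ | b
    · rw [hV1, hV1]
      exact (hS _).trans (hS _).symm
    · have : ∃ i, w (some i) = none := by
        obtain ⟨_ | i, hi⟩ := hw
        · rw [hwn] at hi; cases hi
        · exact ⟨i, hi⟩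
      have h_same := hV' _ this s s'
      exact congrFun h_same b

/-- No combinatorial line inside `A`. -/
def LF {β ι : Type} (A : Set (ι → β)) : Prop := ∀ l : Line β ι, ∃ b, l b ∉ A

lemma LF.pull {β ι η : Type} {A : Set (ι → β)} (h : LF A) (W : Subspace η β ι) :
    LF {x | W x ∈ A} := by
  intro l
  let l' : Line β ι :=
    { idxFun := fun i => (W.idxFun i).elim some l.idxFun
      proper := by
        obtain ⟨e, he⟩ := l.proper
        obtain ⟨i, hi⟩ := W.proper e
        exact ⟨i, by simp [hi, he]⟩ }
  obtain ⟨b, hb⟩ := h l'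
  refine ⟨b, fun hb' => hb ?_⟩
  have : l' b = W (l b) := by
    ext1 i
    simp only [Line.coe_apply, Subspace.coe_apply, l']
    rcases W.idxFun i with c | c <;> simp
  rw [this]
  exact hb'

lemma LF.slice {β ι κ : Type} {A : Set (ι ⊕ κ → β)} (h : LF A) (x : ι → β) :
    LF {y : κ → β | Sum.elim x y ∈ A} := by
  have := h.pull (constProd x (⟨Sum.inr, fun e => ⟨e, rfl⟩⟩ : Subspace κ β κ))
  simp only [constProd_apply] at this
  exact this

lemma main_step {α : Type} [Finite α] [Nonempty α] (hD : DHJ α) (δ : ℝ) (hδ : 0 < δ) (hδ1 : δ ≤ 1)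
    (h1 : ∀ γ : ℝ, 0 < γ → ∀ (ι : Type) [Finite ι], ∃ A : Set (ι → Option α), LF A ∧ δ - γ ≤ dn A)
    (h2 : ∀ γ : ℝ, 0 < γ → ∃ (ι : Type) (_ : Finite ι), ∀ A : Set (ι → Option α), LF A →
      dn A ≤ δ + γ) : False := by
  classical
  have := Fintype.ofFinite α
  obtain ⟨a0⟩ := ‹Nonempty α›
  have : Nonempty α := ⟨a0⟩
  obtain ⟨p, hp', hp⟩ := hD (δ / 2 / 2) (by positivity)
  set θ : ℝ := δ / 2 / 2 / (Nat.card (Line α p) + 1) with hθ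
  have hθ0 : 0 < θ := by positivity
  have hθ1 : θ ≤ 1 / 4 := by
    rw [hθ, div_le_iff₀ (by positivity)]
    have : (0 : ℝ) ≤ Nat.card (Line α p) := by positivity
    linarith
  set L : ℝ := ((Fintype.card (α → Prop) : ℕ) : ℝ) with hL
  have hL0 : 0 < L := by
    have : 0 < Fintype.card (α → Prop) := Fintype.card_pos
    rw [hL]; exact_mod_cast this
  set ρ : ℝ := δ * θ / 8 with hρ
  have hρ0 : 0 < ρ := by positivity
  have hρδ : ρ ≤ δ / 2 := by rw [hρ]; nlinarith
  obtain ⟨η0, hη0', hη0⟩ := h2 ρ hρ0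
  obtain ⟨η, hη', hη⟩ := Tm hD Finset.univ η0 (ρ / L) (by positivity)
  obtain ⟨M, hM', hM⟩ := ramsey (α := α) p Prop η
  set K : ℝ := ((Nat.card (M → Option α) : ℕ) : ℝ) with hK
  have hK0 : 0 < K := by
    have : 0 < Nat.card (M → Option α) := Nat.card_pos
    rw [hK]; exact_mod_cast this
  set ρ' : ℝ := ρ / (2 * K) with hρ'
  have hρ'0 : 0 < ρ' := by positivity
  obtain ⟨n, hn', hn⟩ := h2 ρ' hρ'0
  obtain ⟨A, hA, hdA⟩ := h1 ρ' hρ'0 (M ⊕ n)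
  have hreg : ∀ x : M → Option α, δ - ρ ≤ dn {y : n → Option α | Sum.elim x y ∈ A} := by
    intro x
    have h3 := avg_single (fun x : M → Option α => δ + ρ' - dn {y : n → Option α | Sum.elim x y ∈ A})
      (fun x => by linarith [hn _ (hA.slice x)]) x
    rw [avg_sub, avg_const, ← dn_sumType, div_le_iff₀ hK0] at h3
    have h4 : (δ + ρ' - dn A) * K ≤ (2 * ρ') * K := by
      apply mul_le_mul_of_nonneg_right _ hK0.le
      linarith
    have h5 : (2 * ρ') * K = ρ := by rw [hρ']; field_simp
    linarith
  obtain ⟨V, hV⟩ := hM (fun w => θ ≤ dn {y : n → Option α |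
    ∀ a : α, Sum.elim (fun i => some ((w i).getD a)) y ∈ A})
  let s0 : η → Option α := fun _ => some a0
  obtain ⟨l, hl⟩ := find (X := p → α) (Y := n → Option α)
    (fun x y => Sum.elim (lift V (Sum.elim (fun i => some (x i)) s0)) y ∈ A)
    (show 0 < δ / 2 by positivity) (fun l : Line α p => Set.range l)
    (fun y hy => by
      obtain ⟨l, hl⟩ := hp _ hy
      refine ⟨l, ?_⟩
      rintro _ ⟨b, rfl⟩
      exact hl b) (by
      rw [← dn_prod]
      refine le_avg fun x => ?_
      have := hreg (lift V (Sum.elim (fun i => some (x i)) s0))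
      linarith)
  set w : p → Option α := l.idxFun with hw
  have hsub : ∀ (s : η → Option α) (a : α) i, some ((lift V (Sum.elim w s) i).getD a) =
      lift V (Sum.elim (fun i => some (l a i)) (fun i => some ((s i).getD a))) i := by
    intro s a i
    rw [lift_getD]
    rw [← lift_some]
    congr 2
    ext1 e
    rcases e with e | e <;> rfl
  have hgood : ∀ s : η → Option α, θ ≤ dn {y : n → Option α |
      ∀ a : α, Sum.elim (fun i => some ((lift V (Sum.elim w s) i).getD a)) y ∈ A} := by
    intro s
    have h3 := hV w l.proper s0 s
    rw [← h3]
    refine le_trans hl (dn_mono ?_)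
    intro y hy a
    have h4 := hy (l a) ⟨a, rfl⟩
    have h5 : (fun i => some ((lift V (Sum.elim w s0) i).getD a)) =
        lift V (Sum.elim (fun i => some (l a i)) s0) := by
      ext1 i
      rw [hsub]
      rfl
    rw [h5]
    exact h4
  let B : (n → Option α) → Set (η → Option α) := fun y => {s | Sum.elim (lift V (Sum.elim w s)) y ∈ A}
  let D : (n → Option α) → α → Set (η → Option α) := fun y a =>
    {s | Sum.elim (fun i => some ((lift V (Sum.elim w s) i).getD a)) y ∈ A}
  let C : (n → Option α) → Set (η → Option α) := fun y => {s | ∀ a, s ∈ D y a}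
  have hDins : ∀ y a s s', (∀ i, (s i).getD a = (s' i).getD a) → (s ∈ D y a ↔ s' ∈ D y a) := by
    intro y a s s' h
    have : (fun i => some ((lift V (Sum.elim w s) i).getD a)) =
      (fun i => some ((lift V (Sum.elim w s') i).getD a)) := by
      ext1 i
      rw [hsub, hsub]
      simp only [h]
    simp only [D, Set.mem_ofPred_eq, this]
  have hdisj : ∀ y s, s ∈ C y → s ∉ B y := by
    intro y s hC hB
    let l' : Line (Option α) (M ⊕ n) :=
      { idxFun := Sum.elim (fun i => (lift V (Sum.elim w s) i).map some) (fun j => some (y j))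
        proper := by
          obtain ⟨e, he⟩ := l.proper
          obtain ⟨i, hi⟩ := (lift V).proper (Sum.inl e)
          refine ⟨Sum.inl i, ?_⟩
          rw [Sum.elim_inl, Subspace.apply_inr hi, Sum.elim_inl, hw, he]
          rfl }
    obtain ⟨b, hb⟩ := hA l'
    apply hb
    rcases b with _ | a
    · have : l' none = Sum.elim (lift V (Sum.elim w s)) y := by
        ext1 i
        rcases i with i | j
        · simp only [Line.coe_apply, l', Sum.elim_inl]
          cases lift V (Sum.elim w s) i <;> rfl
        · rfl
      rw [this]; exact hB
    · have : l' (some a) = Sum.elim (fun i => some ((lift V (Sum.elim w s) i).getD a)) y := by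
        ext1 i
        rcases i with i | j
        · simp only [Line.coe_apply, l', Sum.elim_inl]
          cases lift V (Sum.elim w s) i <;> rfl
        · rfl
      rw [this]; exact hC a
  have hBLF : ∀ y, LF (B y) := by
    intro y
    let U : Subspace η (Option α) (M ⊕ n) :=
      { idxFun := Sum.elim (fun i => ((lift V).idxFun i).elim Sum.inl
          (Sum.elim (fun e => Sum.inl (w e)) Sum.inr)) (fun j => Sum.inl (y j))
        proper := fun e => by
          obtain ⟨i, hi⟩ := (lift V).proper (Sum.inr e)
          exact ⟨Sum.inl i, by simp [hi]⟩ }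
    have hU : ∀ s, U s = Sum.elim (lift V (Sum.elim w s)) y := by
      intro s
      ext1 i
      rcases i with i | j
      · simp only [Subspace.coe_apply, U, Sum.elim_inl]
        rcases (lift V).idxFun i with b | (b | b) <;> rfl
      · rfl
    have := hA.pull U
    simpa only [hU] using this
  have hy : ∀ y, dn (B y) - (δ + ρ) + δ * dn (C y) ≤ 2 * ρ := by
    intro y
    let f : (η → Option α) → ℝ := fun s => ((B y).indicator (fun _ => (1 : ℝ)) s - (δ + ρ)) / 2
    have hf : ∀ s, |f s| ≤ 1 := by
      intro s
      rw [abs_le]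
      by_cases hs : s ∈ B y <;> simp only [f, hs, Set.indicator_of_mem, Set.indicator_of_notMem,
        not_false_iff] <;> constructor <;> linarith
    let P : (α → Prop) → Set (η → Option α) := fun σ => {s | ∀ a ∈ Finset.univ, s ∈ {s | s ∈ D y a ↔ σ a}}
    have h3 : ∀ σ, avg ((P σ).indicator f) ≤ 0 + ρ / L := by
      intro σ
      refine hη (fun a => {s | s ∈ D y a ↔ σ a}) ?_ f hf 0 le_rfl ?_
      · intro a _ s s' h hs
        exact (hDins y a s s' h).symm.trans hs
      · intro W
        have h4 : dn {x | W x ∈ B y} ≤ δ + ρ := hη0 _ ((hBLF y).pull W)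
        have h5 : (avg fun x => f (W x)) = (1 / 2) * (dn {x | W x ∈ B y} - (δ + ρ)) := by
          rw [dn, ← avg_const (X := η0 → Option α) (δ + ρ), ← avg_sub, ← avg_mul]
          congr 1
          ext x
          simp only [f, Set.indicator_apply, Set.mem_ofPred_eq]
          ring
        rw [h5]
        linarith
    have h6 : ∀ s, (C y)ᶜ.indicator f s ≤ ∑ σ : α → Prop, if σ = (fun _ => True) then 0 else (P σ).indicator f s := by
      intro s
      have h7 : ∀ σ, s ∈ P σ ↔ σ = fun a => s ∈ D y a := by
        intro σ
        simp only [P, Finset.mem_univ, true_imp_iff, Set.mem_ofPred_eq]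
        constructor
        · intro h; ext a; exact (h a).symm
        · rintro rfl a; rfl
      have h8 : (∑ σ : α → Prop, if σ = (fun _ => True) then 0 else (P σ).indicator f s) =
          if (fun a => s ∈ D y a) = (fun _ => True) then 0 else f s := by
        rw [Finset.sum_eq_single (fun a => s ∈ D y a)]
        · simp only [Set.indicator_apply, h7, if_true]
        · intro σ _ hσ
          simp only [Set.indicator_apply, h7, hσ, if_false, ite_self]
        · simp
      rw [h8]
      have h9 : ((fun a => s ∈ D y a) = (fun _ => True)) ↔ s ∈ C y := by
        simp [funext_iff, C]
      simp only [h9, Set.indicator_apply, Set.mem_compl_iff]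
      split_ifs <;> simp_all
    have h10 := avg_mono h6
    rw [avg_sum] at h10
    have h11 : ∑ σ : α → Prop, (avg fun s => if σ = (fun _ => True) then 0 else (P σ).indicator f s) ≤
        ∑ σ : α → Prop, ρ / L := by
      apply Finset.sum_le_sum
      intro σ _
      by_cases hσ : σ = fun _ => True
      · simp only [hσ, if_true, avg_const]; positivity
      · simp only [hσ, if_false]
        have := h3 σ
        rw [zero_add] at this
        exact this
    rw [Finset.sum_const, Finset.card_univ, nsmul_eq_mul, ← hL, mul_div_cancel₀ _ hL0.ne'] at h11
    have h12 : avg ((C y)ᶜ.indicator f) = (1 / 2) * (dn (B y) - (δ + ρ) + (δ + ρ) * dn (C y)) := by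
      rw [dn, dn, ← avg_mul, ← avg_const (X := η → Option α) (δ + ρ), ← avg_sub, ← avg_add, ← avg_mul]
      congr 1
      ext s
      simp only [avg_const]
      by_cases hs : s ∈ C y
      · have := hdisj y s hs
        simp [hs, this]
      · simp [hs, f]; ring
    have h13 : 0 ≤ ρ * dn (C y) := mul_nonneg hρ0.le (dn_nonneg _)
    rw [h12] at h10
    nlinarith
  have h20 := avg_le hy
  rw [avg_add, avg_sub, avg_const, avg_mul] at h20
  have h21 : δ - ρ ≤ avg fun y => dn (B y) := by
    rw [← dn_prod (fun (s : η → Option α) (y : n → Option α) => Sum.elim (lift V (Sum.elim w s)) y ∈ A)]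
    exact le_avg fun s => hreg _
  have h22 : θ ≤ avg fun y => dn (C y) := by
    rw [← dn_prod (fun (s : η → Option α) (y : n → Option α) => ∀ a, s ∈ D y a)]
    exact le_avg fun s => hgood s
  have h23 := mul_le_mul_of_nonneg_left h22 hδ.le
  have : δ * θ = 8 * ρ := by rw [hρ]; ring
  linarith

end RMR

namespace RMR
open Combinatorics
set_option linter.unusedSectionVars false

lemma DHJ.of_equiv {α β : Type} [Finite α] [Finite β] (e : α ≃ β) (h : DHJ α) : DHJ β := by
  intro δ hδ
  obtain ⟨ι, hι, H⟩ := h δ hδ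
  refine ⟨ι, hι, fun A hA => ?_⟩
  let E : (ι → α) ≃ (ι → β) := Equiv.arrowCongr (Equiv.refl ι) e
  have h1 : dn {x | E x ∈ A} = dn A := by
    rw [dn, dn, ← avg_equiv E]
    congr 1
  obtain ⟨l, hl⟩ := H {x | E x ∈ A} (by rw [h1]; exact hA)
  let l' : Line β ι :=
    { idxFun := fun i => (l.idxFun i).map e
      proper := by
        obtain ⟨i, hi⟩ := l.proper
        exact ⟨i, by simp [hi]⟩ }
  refine ⟨l', fun b => ?_⟩
  have h2 := hl (e.symm b)
  have h3 : l' b = E (l (e.symm b)) := by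
    ext1 i
    simp only [Line.coe_apply, l', E, Equiv.arrowCongr_apply, Function.comp, Equiv.refl_symm,
      Equiv.refl_apply]
    cases l.idxFun i <;> simp
  rw [h3]
  exact h2

lemma DHJ.subsingleton {α : Type} [Finite α] [Subsingleton α] : DHJ α := by
  intro δ hδ
  refine ⟨Unit, inferInstance, fun A hA => ?_⟩
  obtain ⟨x, hx⟩ := nonempty_of_dn (hδ.trans_le hA)
  refine ⟨Line.diagonal α Unit, fun a => ?_⟩
  rwa [Subsingleton.elim ((Line.diagonal α Unit) a) x]

lemma DHJ.option {α : Type} [Finite α] (h : DHJ α) : DHJ (Option α) := by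
  rcases isEmpty_or_nonempty α with h0 | h0
  · exact DHJ.subsingleton
  by_contra hcon
  unfold DHJ at hcon
  push Not at hcon
  obtain ⟨δ0, hδ0, H⟩ := hcon
  let S : Set ℝ := {δ | ∀ (ι : Type) [Finite ι], ∃ A : Set (ι → Option α), LF A ∧ δ ≤ dn A}
  have hS0 : δ0 ∈ S := by
    intro ι hι
    obtain ⟨A, hA, hl⟩ := H ι hι
    exact ⟨A, hl, hA⟩
  have hS1 : ∀ δ ∈ S, δ ≤ 1 := by
    intro δ hδ
    obtain ⟨A, _, hA⟩ := hδ Unit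
    exact hA.trans (dn_le_one A)
  have hb : BddAbove S := ⟨1, hS1⟩
  refine main_step h (sSup S) (hδ0.trans_le (le_csSup hb hS0)) (csSup_le ⟨_, hS0⟩ hS1) ?_ ?_
  · intro γ hγ ι _
    obtain ⟨s, hs, hs'⟩ := exists_lt_of_lt_csSup ⟨_, hS0⟩ (show sSup S - γ < sSup S by linarith)
    obtain ⟨A, hA, hA'⟩ := hs ι
    exact ⟨A, hA, by linarith⟩
  · intro γ hγ
    by_contra hc
    have : sSup S + γ ∈ S := by
      intro ι hι
      by_contra hc'
      apply hc
      refine ⟨ι, hι, fun A hA => ?_⟩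
      by_contra hlt
      exact hc' ⟨A, hA, (not_le.1 hlt).le⟩
    have := le_csSup hb this
    linarith

/-- The density Hales-Jewett theorem. -/
theorem dhj (α : Type) [hα : Finite α] : DHJ α := by
  refine (Finite.induction_empty_option (P := fun α => Finite α ∧ DHJ α) ?_ ?_ ?_ α).2
  · rintro α β e ⟨h1, h2⟩
    have : Finite β := Finite.of_equiv _ e
    exact ⟨this, h2.of_equiv e⟩
  · exact ⟨inferInstance, DHJ.subsingleton⟩
  · rintro α _ ⟨h1, h2⟩
    exact ⟨inferInstance, h2.option⟩

end RMR

namespace RMR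
open Combinatorics
set_option linter.unusedSectionVars false

/-- Composition of the transformations labelled by the letters of a word, along a list. -/
def word {X : Type*} {β ι : Type} (U : β → X → X) (w : ι → β) (L : List ι) : X → X :=
  L.foldr (fun i f => U (w i) ∘ f) id

lemma word_mp {X : Type*} [MeasurableSpace X] {μ : Measure X} {β ι : Type} {U : β → X → X}
    (hU : ∀ b, MeasurePreserving (U b) μ μ) (w : ι → β) (L : List ι) :
    MeasurePreserving (word U w L) μ μ := by
  induction L with
  | nil => exact MeasurePreserving.id μ
  | cons i L ih => exact (hU (w i)).comp ih

lemma word_line {X : Type*} {α ι : Type} {U : Option α → X → X}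
    (hU : ∀ a b, Function.Commute (U a) (U b)) (h0 : U none = id)
    (l : Line (Option α) ι) (a : Option α) (L : List ι) :
    word U (l a) L = (U a)^[L.countP (fun i => (l.idxFun i).isNone)] ∘ word U (l none) L := by
  induction L with
  | nil => rfl
  | cons i L ih =>
    change U (l a i) ∘ word U (l a) L = _ ∘ (U (l none i) ∘ word U (l none) L)
    rw [ih, List.countP_cons]
    rcases hi : l.idxFun i with _ | b
    · have h1 : ∀ c, l c i = c := fun c => by simp [Line.coe_apply, hi]
      rw [h1, h1, h0]
      simp only [Option.isNone_none, if_true, Function.id_comp]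
      rw [Function.iterate_succ', Function.comp_assoc]
    · have h1 : ∀ c, l c i = b := fun c => by simp [Line.coe_apply, hi]
      rw [h1, h1]
      simp only [Option.isNone_some, Bool.false_eq_true, if_false, add_zero]
      rw [← Function.comp_assoc, ← Function.comp_assoc]
      congr 1
      ext x
      exact ((hU b a).iterate_right _ x)

lemma recur {X : Type*} [MeasurableSpace X] (μ : Measure X) [IsProbabilityMeasure μ]
    (A : Set X) (hA : MeasurableSet A) (hA0 : 0 < μ A) (k : ℕ) :
    ∃ N : ℕ, 1 ≤ N ∧ ∀ U : Option (Fin k) → X → X, U none = id →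
      (∀ a, MeasurePreserving (U a) μ μ) → (∀ a b, Function.Commute (U a) (U b)) →
      ∃ q, 1 ≤ q ∧ q ≤ N ∧ 0 < μ (⋂ a, (U a)^[q] ⁻¹' A) := by
  classical
  have hm : 0 < μ.real A := by
    rw [measureReal_def]; exact ENNReal.toReal_pos hA0.ne' (measure_ne_top _ _)
  obtain ⟨ι, hι, H⟩ := dhj (Option (Fin k)) (μ.real A / 2) (by positivity)
  have := Fintype.ofFinite ι
  refine ⟨Fintype.card ι + 1, by omega, fun U h0 hU hc => ?_⟩
  let S : (ι → Option (Fin k)) → X → X := fun w => word U w Finset.univ.toList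
  have hS : ∀ w, MeasurePreserving (S w) μ μ := fun w => word_mp hU w _
  have key : ∃ l : Line (Option (Fin k)) ι, 0 < μ {y | ∀ a, S (l a) y ∈ A} := by
    by_contra! hcon
    have hae : ∀ᵐ y ∂μ, ∀ l : Line (Option (Fin k)) ι, ¬ ∀ a, S (l a) y ∈ A := by
      rw [ae_all_iff]
      intro l
      have := nonpos_iff_eq_zero.1 (hcon l)
      rw [ae_iff]
      simpa only [not_not] using this
    have h1 : ∀ᵐ y ∂μ, dn {w | S w y ∈ A} ≤ μ.real A / 2 := by
      filter_upwards [hae] with y hy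
      by_contra! hlt
      obtain ⟨l, hl⟩ := H _ hlt.le
      exact hy l hl
    have h_integrable : ∀ w, Integrable ((S w ⁻¹' A).indicator (fun _ => (1 : ℝ))) μ := fun w =>
      (integrable_const 1).indicator ((hS w).measurable hA)
    have h2 : ∀ y, dn {w | S w y ∈ A} =
        (∑ w, (S w ⁻¹' A).indicator (fun _ => (1 : ℝ)) y) / Fintype.card (ι → Option (Fin k)) := by
      intro y
      rw [dn, avg_fin]
      rfl
    have h3 : ∫ y, dn {w | S w y ∈ A} ∂μ = μ.real A := by
      simp only [h2]
      rw [integral_div, integral_finsetSum _ (fun w _ => h_integrable w)]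
      have h4 : ∀ w, ∫ y, (S w ⁻¹' A).indicator (fun _ => (1 : ℝ)) y ∂μ = μ.real A := by
        intro w
        rw [integral_indicator ((hS w).measurable hA)]
        simp only [integral_const, smul_eq_mul, mul_one, measureReal_restrict_apply_univ]
        rw [measureReal_def, (hS w).measure_preimage hA.nullMeasurableSet, measureReal_def]
      simp only [h4, Finset.sum_const, Finset.card_univ, nsmul_eq_mul]
      rw [mul_div_cancel_left₀]
      exact_mod_cast Fintype.card_ne_zero
    have h5 : ∫ y, dn {w | S w y ∈ A} ∂μ ≤ ∫ y, μ.real A / 2 ∂μ := by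
      refine integral_mono_ae ?_ (integrable_const _) h1
      simp only [h2]
      exact (integrable_finsetSum _ (fun w _ => h_integrable w)).div_const _
    rw [h3] at h5
    simp at h5
    linarith
  obtain ⟨l, hl⟩ := key
  refine ⟨Finset.univ.toList.countP (fun i => (l.idxFun i).isNone), ?_, ?_, ?_⟩
  · rw [Nat.succ_le_iff, List.countP_pos_iff]
    obtain ⟨i, hi⟩ := l.proper
    exact ⟨i, by simp, by simp [hi]⟩
  · have := List.countP_le_length (p := fun i => (l.idxFun i).isNone) (l := (Finset.univ : Finset ι).toList)
    rw [Finset.length_toList, Finset.card_univ] at this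
    omega
  · have hset : {y | ∀ a, S (l a) y ∈ A} = S (l none) ⁻¹'
        (⋂ a, (U a)^[Finset.univ.toList.countP (fun i => (l.idxFun i).isNone)] ⁻¹' A) := by
      ext y
      simp only [Set.mem_ofPred_eq, Set.mem_preimage, Set.mem_iInter]
      refine forall_congr' fun a => ?_
      simp only [S]
      rw [word_line hc h0 l a]
      rfl
    rw [hset, (hS _).measure_preimage] at hl
    · exact hl
    · exact (MeasurableSet.iInter fun a => ((hU a).iterate _).measurable hA).nullMeasurableSet

end RMR

/-- Multiple recurrence for rational systems: given `k` commuting rational systems of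
measure preserving transformations of a probability space and a set `A` of positive
measure, there are a nonempty finite set `F ⊆ ℤ \ {0}` and dominated exponents
`1 ≤ q_t ≤ |t|` with `μ(A ∩ 𝒯_1⁻¹(A) ∩ … ∩ 𝒯_k⁻¹(A)) > 0`; the recurrence is achieved
at the nonzero rational `Σ_{t∈F} q_t·c_t`. -/
theorem rational_multiple_recurrence {X : Type*} [MeasurableSpace X] (μ : Measure X)
    [IsProbabilityMeasure μ] (k : ℕ) (T : Fin k → ℤ → X → X)
    (hmp : ∀ j, ∀ n ≠ 0, MeasurePreserving (T j n) μ μ)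
    (hcomm : ∀ i j, ∀ m ≠ 0, ∀ n ≠ 0, T i m ∘ T j n = T j n ∘ T i m)
    (A : Set X) (hA : MeasurableSet A) (hA0 : 0 < μ A) :
    ∃ F : Finset ℤ, F.Nonempty ∧ (∀ t ∈ F, t ≠ 0) ∧
      ∃ q : ℤ → ℕ, (∀ t ∈ F, 1 ≤ q t ∧ q t ≤ t.natAbs) ∧
        (∑ t ∈ F, (q t : ℚ) * ratCoeff t) ≠ 0 ∧
        0 < μ (A ∩ ⋂ j : Fin k, ratTrans (T j) q F ⁻¹' A) := by
  obtain ⟨N, hN, H⟩ := RMR.recur μ A hA hA0 k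
  have ht : (N : ℤ) ≠ 0 := by omega
  obtain ⟨q, hq1, hqN, hq⟩ := H (fun a => a.elim id (fun j => T j N)) rfl
    (by
      rintro (_ | j)
      · exact MeasurePreserving.id μ
      · exact hmp j _ ht)
    (by
      rintro (_ | i) (_ | j) x
      · rfl
      · rfl
      · rfl
      · exact congrFun (hcomm i j _ ht _ ht) x)
  refine ⟨{(N : ℤ)}, Finset.singleton_nonempty _, by simpa using ht, fun _ => q, ?_, ?_, ?_⟩
  · intro t h
    rw [Finset.mem_singleton] at h
    subst h
    exact ⟨hq1, by simpa using hqN⟩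
  · rw [Finset.sum_singleton]
    refine mul_ne_zero (by exact_mod_cast (by omega : q ≠ 0)) ?_
    unfold ratCoeff
    rw [if_neg (by omega)]
    refine mul_ne_zero (pow_ne_zero _ (by norm_num)) ?_
    exact_mod_cast Nat.factorial_ne_zero _
  · refine hq.trans_le (measure_mono ?_)
    intro y hy
    rw [Set.mem_iInter] at hy
    refine ⟨?_, Set.mem_iInter.2 fun j => ?_⟩
    · have := hy none
      simpa using this
    · have := hy (some j)
      simpa [ratTrans] using this
end
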